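/- arXiv:2402.18693 — 2 statements merged into one kernel-verified Lean document; each statement's English description precedes it below -/
import Mathlib

section
/- Let k be a field of characteristic zero, R = k[x_1,…,x_n], and for j ≤ n let X_j be the j×(n+1−j) Hankel matrix whose (a,b)-entry is x_{a+b−1}. For 1 ≤ t ≤ min{j, n+1−j} let I_t(X_j) be the ideal generated by all t×t minors of X_j, and set m := ⌊(n+1)/2⌋. Then for every positive integer k and every integer 0 ≤ l ≤ m−t, α(I_t(X_j)^{(k(m−t+1)−l)}) = km − l; moreover, the Waldschmidt constant of I_t(X_j) equals m/(m−t+1), i.e., α(I_t(X_j)^{(s)})/s → m/(m−t+1) as s → ∞. -/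
open MvPolynomial Filter


/-- The `s`-th symbolic power of an ideal: the intersection over the associated primes `p` of
`R ⧸ I` of the contractions of `I^s` localized at `p`. -/
noncomputable def symbolicPower {R : Type*} [CommRing R] (I : Ideal R) (s : ℕ) : Ideal R :=
  ⨅ p : {p : Ideal R // p ∈ associatedPrimes R (R ⧸ I)},
    letI : p.1.IsPrime := p.2.isPrime
    Ideal.comap (algebraMap R (Localization.AtPrime p.1))
      (Ideal.map (algebraMap R (Localization.AtPrime p.1)) (I ^ s))

/-- The least degree of a nonzero homogeneous element of an ideal of a polynomial ring. -/
noncomputable def alphaDeg {σ K : Type*} [CommSemiring K] (I : Ideal (MvPolynomial σ K)) : ℕ :=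
  sInf {d | ∃ f ∈ I, f ≠ 0 ∧ MvPolynomial.IsHomogeneous f d}


namespace HankelAux
variable {K : Type*} [Field K] {n m : ℕ}

noncomputable def phi (K : Type*) [Field K] (n : ℕ) {m : ℕ} (E : Finset (Fin m)) :
    MvPolynomial (Fin n) K →ₐ[K] MvPolynomial (Fin m) (MvPolynomial (Fin m) K) :=
  aeval (fun c : Fin n => ∑ k ∈ E, X k * C (X k ^ (c : ℕ)))

def wt (N : Fin n →₀ ℕ) : ℕ := ∑ c : Fin n, N c * (c : ℕ) ^ 2

abbrev Pos (N : Fin n →₀ ℕ) := Σ c : Fin n, Fin (N c)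

lemma sum_pos {A : Type*} [CommSemiring A] (N : Fin n →₀ ℕ) (h : Fin n → A) :
    ∑ p : Pos N, h p.1 = ∑ c, (N c : A) * h c := by
  rw [Fintype.sum_sigma]
  simp

lemma prod_pos {A : Type*} [CommSemiring A] (N : Fin n →₀ ℕ) (h : Fin n → A) :
    ∏ p : Pos N, h p.1 = ∏ c, (h c) ^ (N c) := by
  rw [Fintype.prod_sigma]
  simp

lemma prod_monomial {ι σ A : Type*} [CommSemiring A] (s : Finset ι) (f : ι → σ →₀ ℕ) (g : ι → A) :
    ∏ p ∈ s, monomial (f p) (g p) = monomial (∑ p ∈ s, f p) (∏ p ∈ s, g p) := by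
  classical
  induction s using Finset.induction_on with
  | empty => simp
  | insert a s ha ih => rw [Finset.prod_insert ha, ih, Finset.sum_insert ha, Finset.prod_insert ha,
      monomial_mul]

lemma phi_monomial (E : Finset (Fin m)) (N : Fin n →₀ ℕ) :
    phi K n E (monomial N 1) = ∑ κ ∈ Fintype.piFinset (fun _ : Pos N => E),
      monomial (∑ p, Finsupp.single (κ p) 1)
        (monomial (∑ p : Pos N, Finsupp.single (κ p) (p.1 : ℕ)) (1 : K)) := by
  have h1 : phi K n E (monomial N 1) = ∏ p : Pos N, ∑ k ∈ E,
      monomial (Finsupp.single k 1) (monomial (Finsupp.single k (p.1 : ℕ)) (1 : K)) := by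
    rw [prod_pos N (fun c : Fin n => ∑ k ∈ E,
      monomial (Finsupp.single k 1) (monomial (Finsupp.single k (c : ℕ)) (1 : K)))]
    rw [phi, aeval_monomial, Finsupp.prod_fintype _ _ (by simp)]
    simp only [map_one, one_mul]
    refine Finset.prod_congr rfl fun c _ => ?_
    congr 1
    refine Finset.sum_congr rfl fun k _ => ?_
    rw [X_pow_eq_monomial, mul_comm, X, C_mul_monomial, mul_one]
  rw [h1, Finset.prod_univ_sum]
  refine Finset.sum_congr rfl fun κ _ => ?_
  rw [prod_monomial, prod_monomial]
  simp

open Classical in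
lemma coeff_phi_monomial (E : Finset (Fin m)) (N : Fin n →₀ ℕ) (α e : Fin m →₀ ℕ) :
    coeff e (coeff α (phi K n E (monomial N 1))) =
      (((Fintype.piFinset (fun _ : Pos N => E)).filter (fun κ =>
        ∑ p, Finsupp.single (κ p) 1 = α ∧
        ∑ p : Pos N, Finsupp.single (κ p) (p.1 : ℕ) = e)).card : K) := by
  rw [phi_monomial, coeff_sum, coeff_sum, Finset.card_filter, Nat.cast_sum]
  refine Finset.sum_congr rfl fun κ _ => ?_
  rw [coeff_monomial]
  split_ifs with h1 h2 h2
  · rw [coeff_monomial, if_pos h2.2]; simp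
  · rw [coeff_monomial, if_neg (fun h => h2 ⟨h1, h⟩)]; simp
  · exact absurd h2.1 h1
  · simp

lemma sum_eq_of (N : Fin n →₀ ℕ) (κ : Pos N → Fin m) (F G : Fin m → ℤ) :
    ∑ p : Pos N, (F (κ p) + G (κ p) * ((p.1 : ℕ) : ℤ)) =
      ∑ k, (((∑ p, Finsupp.single (κ p) 1 : Fin m →₀ ℕ) k : ℤ) * F k +
      ((∑ p : Pos N, Finsupp.single (κ p) (p.1 : ℕ) : Fin m →₀ ℕ) k : ℤ) * G k) := by
  simp only [Finsupp.coe_finsetSum, Finset.sum_apply, Nat.cast_sum, Finset.sum_mul,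
    Finset.sum_add_distrib]
  congr 1
  · rw [Finset.sum_comm]
    refine Finset.sum_congr rfl fun p _ => ?_
    rw [Finset.sum_eq_single (κ p)]
    · simp
    · intro b _ hb; simp [hb.symm]
    · simp
  · rw [Finset.sum_comm]
    refine Finset.sum_congr rfl fun p _ => ?_
    rw [Finset.sum_eq_single (κ p)]
    · simp [mul_comm]
    · intro b _ hb; simp [hb.symm]
    · simp

lemma key (i : Fin m → ℕ) (M N : Fin n →₀ ℕ) (β : Pos M → Fin m) (κ : Pos N → Fin m)
    (hβ : ∀ p : Pos M, (p.1 : ℕ) = i (β p) ∨ (p.1 : ℕ) = i (β p) + 1)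
    (h1 : (∑ p, Finsupp.single (κ p) 1 : Fin m →₀ ℕ) = ∑ p, Finsupp.single (β p) 1)
    (h2 : (∑ p : Pos N, Finsupp.single (κ p) (p.1 : ℕ) : Fin m →₀ ℕ) =
      ∑ p : Pos M, Finsupp.single (β p) (p.1 : ℕ))
    (hw : wt N ≤ wt M) : N = M := by
  have hS : ∀ F G : Fin m → ℤ, ∑ p : Pos N, (F (κ p) + G (κ p) * ((p.1 : ℕ) : ℤ)) =
      ∑ p : Pos M, (F (β p) + G (β p) * ((p.1 : ℕ) : ℤ)) := by
    intro F G
    rw [sum_eq_of, sum_eq_of, h1, h2]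
  have hwt : ∀ N : Fin n →₀ ℕ, (wt N : ℤ) = ∑ p : Pos N, ((p.1 : ℕ) : ℤ) ^ 2 := by
    intro N
    rw [sum_pos N (fun c : Fin n => ((c : ℕ) : ℤ) ^ 2)]
    simp [wt]
  have hq : ∀ (N : Fin n →₀ ℕ) (κ : Pos N → Fin m),
      ∑ p : Pos N, (((p.1 : ℕ) : ℤ) - i (κ p)) * (((p.1 : ℕ) : ℤ) - i (κ p) - 1) =
      wt N + ∑ p : Pos N, ((fun k => (i k : ℤ) * (i k + 1)) (κ p) +
        (fun k => -(2 * (i k : ℤ) + 1)) (κ p) * ((p.1 : ℕ) : ℤ)) := by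
    intro N κ
    rw [hwt, ← Finset.sum_add_distrib]
    refine Finset.sum_congr rfl fun p _ => ?_
    ring
  have hM : ∑ p : Pos M, (((p.1 : ℕ) : ℤ) - i (β p)) * (((p.1 : ℕ) : ℤ) - i (β p) - 1) = 0 := by
    refine Finset.sum_eq_zero fun p _ => ?_
    rcases hβ p with h | h <;> rw [h] <;> push_cast <;> ring
  have hnn : ∀ p : Pos N, 0 ≤ (((p.1 : ℕ) : ℤ) - i (κ p)) * (((p.1 : ℕ) : ℤ) - i (κ p) - 1) := by
    intro p
    rcases le_or_gt (((p.1 : ℕ) : ℤ) - i (κ p)) 0 with h | h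
    · nlinarith
    · have : 0 ≤ ((p.1 : ℕ) : ℤ) - i (κ p) - 1 := by omega
      positivity
  have hN0 : ∑ p : Pos N, (((p.1 : ℕ) : ℤ) - i (κ p)) * (((p.1 : ℕ) : ℤ) - i (κ p) - 1) = 0 := by
    refine le_antisymm ?_ (Finset.sum_nonneg fun p _ => hnn p)
    rw [hq M β] at hM
    rw [hq N κ, hS (fun k => (i k : ℤ) * (i k + 1)) (fun k => -(2 * (i k : ℤ) + 1))]
    have : (wt N : ℤ) ≤ wt M := by exact_mod_cast hw
    linarith
  rw [Finset.sum_eq_zero_iff_of_nonneg (fun p _ => hnn p)] at hN0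
  have hκ : ∀ p : Pos N, (p.1 : ℕ) = i (κ p) ∨ (p.1 : ℕ) = i (κ p) + 1 := by
    intro p
    rcases mul_eq_zero.1 (hN0 p (Finset.mem_univ _)) with h | h
    · left; omega
    · right; omega
  have hc : ∀ (c : Fin n) (N : Fin n →₀ ℕ) (κ : Pos N → Fin m)
      (hκ : ∀ p : Pos N, (p.1 : ℕ) = i (κ p) ∨ (p.1 : ℕ) = i (κ p) + 1),
      (N c : ℤ) = ∑ p : Pos N, (
        (fun k => if i k = (c : ℕ) then 1 + (c : ℤ) else if i k + 1 = (c : ℕ) then -(i k : ℤ) else 0) (κ p) +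
        (fun k => if i k = (c : ℕ) then (-1 : ℤ) else if i k + 1 = (c : ℕ) then 1 else 0) (κ p)
          * ((p.1 : ℕ) : ℤ)) := by
    intro c N κ hκ
    have : (N c : ℤ) = ∑ p : Pos N, (fun c' : Fin n => if c' = c then (1 : ℤ) else 0) p.1 := by
      rw [sum_pos N (fun c' : Fin n => if c' = c then (1 : ℤ) else 0)]; simp
    rw [this]
    refine Finset.sum_congr rfl fun p _ => ?_
    have := hκ p
    simp only [Fin.ext_iff]
    split_ifs <;> omega
  ext c
  have := hc c N κ hκ
  rw [hS (fun k => if i k = (c : ℕ) then 1 + (c : ℤ) else if i k + 1 = (c : ℕ) then -(i k : ℤ) else 0)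
    (fun k => if i k = (c : ℕ) then (-1 : ℤ) else if i k + 1 = (c : ℕ) then 1 else 0),
    ← hc c M β hβ] at this
  exact_mod_cast this

def Cov (E : Finset (Fin m)) (N : Fin n →₀ ℕ) : Prop :=
  ∃ i : Fin m → ℕ, ∀ c : Fin n, N c ≠ 0 → ∃ k ∈ E, (c : ℕ) = i k ∨ (c : ℕ) = i k + 1

lemma phi_ne_zero [CharZero K] (E : Finset (Fin m)) (f : MvPolynomial (Fin n) K)
    (hf : f ≠ 0) (hc : ∀ N ∈ f.support, Cov E N) : phi K n E f ≠ 0 := by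
  classical
  obtain ⟨M, hM, hmax⟩ := Finset.exists_max_image f.support wt (support_nonempty.2 hf)
  obtain ⟨i, hi⟩ := hc M hM
  have hpos : ∀ p : Pos M, M p.1 ≠ 0 := fun p => by have := p.2.2; omega
  choose β hβE hβ using fun p : Pos M => hi p.1 (hpos p)
  intro h0
  have hsum : phi K n E f = ∑ N ∈ f.support, f.coeff N • phi K n E (monomial N 1) := by
    conv_lhs => rw [f.as_sum, map_sum]
    refine Finset.sum_congr rfl fun N _ => ?_
    rw [← map_smul, smul_monomial, smul_eq_mul, mul_one]
  set α : Fin m →₀ ℕ := ∑ p, Finsupp.single (β p) 1 with hα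
  set e : Fin m →₀ ℕ := ∑ p : Pos M, Finsupp.single (β p) (p.1 : ℕ) with he
  have h1 : coeff e (coeff α (phi K n E f)) = f.coeff M * coeff e (coeff α (phi K n E (monomial M 1))) := by
    rw [hsum, coeff_sum, coeff_sum, Finset.sum_eq_single M]
    · rw [coeff_smul, coeff_smul, smul_eq_mul]
    · intro N hN hNM
      rw [coeff_smul, coeff_smul, coeff_phi_monomial, Finset.card_eq_zero.2, Nat.cast_zero, smul_zero]
      rw [Finset.filter_eq_empty_iff]
      rintro κ - ⟨h1, h2⟩
      exact hNM (key i M N β κ hβ h1 h2 (hmax N hN))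
    · intro h; exact absurd hM h
  rw [h0, coeff_zero, coeff_zero, coeff_phi_monomial] at h1
  symm at h1
  rcases mul_eq_zero.1 h1 with h | h
  · exact (mem_support_iff.1 hM) h
  · rw [Nat.cast_eq_zero, Finset.card_eq_zero, Finset.filter_eq_empty_iff] at h
    exact h (x := β) (by simpa using hβE) ⟨rfl, rfl⟩


lemma det_mul_eq_zero {A ι : Type*} [CommRing A] [IsDomain A] [Fintype ι] (τ : Type*) [Fintype τ] [DecidableEq τ]
    (h : Fintype.card ι < Fintype.card τ) (P : Matrix (τ) ι A) (Q : Matrix ι (τ) A) :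
    (P * Q).det = 0 := by
  rw [← Matrix.exists_mulVec_eq_zero_iff]
  have hni : ¬ Function.Injective Q.mulVecLin := by
    intro hi
    have e : (Fin (Fintype.card τ) → A) ≃ₗ[A] (τ → A) :=
      LinearEquiv.funCongrLeft A A (Fintype.equivFin τ)
    have e' : (ι → A) ≃ₗ[A] (Fin (Fintype.card ι) → A) :=
      LinearEquiv.funCongrLeft A A (Fintype.equivFin ι).symm
    have := card_le_of_injective A (e'.toLinearMap ∘ₗ Q.mulVecLin ∘ₗ e.toLinearMap)
      (e'.injective.comp (hi.comp e.injective))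
    simp at this
    omega
  rw [← LinearMap.ker_eq_bot, Submodule.eq_bot_iff] at hni
  push Not at hni
  obtain ⟨v, hv, hv0⟩ := hni
  refine ⟨v, hv0, ?_⟩
  rw [← Matrix.mulVec_mulVec]
  have : Q.mulVec v = 0 := hv
  rw [this, Matrix.mulVec_zero]

/-- A general Hankel minor. -/
noncomputable def hk (K : Type*) [Field K] {n : ℕ} {τ : Type*} [Fintype τ] [DecidableEq τ]
    (r c : τ → ℕ) (h : ∀ a b, r a + c b < n) :
    MvPolynomial (Fin n) K :=
  Matrix.det (Matrix.of fun a b => (X ⟨r a + c b, h a b⟩ : MvPolynomial (Fin n) K))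

lemma phi_hk {τ : Type*} [Fintype τ] [DecidableEq τ] (E : Finset (Fin m)) (hE : E.card < Fintype.card τ) (r c : τ → ℕ)
    (h : ∀ a b, r a + c b < n) : phi K n E (hk K r c h) = 0 := by
  rw [hk, AlgHom.map_det]
  rw [← det_mul_eq_zero (ι := E) τ (by simpa using hE)
    (Matrix.of fun a k => (X k.1 * C (X k.1 ^ r a) : MvPolynomial (Fin m) (MvPolynomial (Fin m) K)))
    (Matrix.of fun k b => C (X k.1 ^ c b))]
  congr 1
  ext1 a b
  rw [Matrix.mul_apply]
  simp only [AlgHom.mapMatrix_apply, Matrix.map_apply, Matrix.of_apply, phi, aeval_X]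
  rw [← Finset.sum_coe_sort E]
  refine Finset.sum_congr rfl fun k _ => ?_
  rw [pow_add, C_mul, mul_assoc]

noncomputable def HI (K : Type*) [Field K] (n j t : ℕ) : Ideal (MvPolynomial (Fin n) K) :=
  Ideal.span {d |
      ∃ (ri : Fin t → Fin j) (ci : Fin t → Fin (n + 1 - j)),
        Function.Injective ri ∧ Function.Injective ci ∧
        d = Matrix.det (Matrix.of fun a b =>
          (MvPolynomial.X ⟨(ri a).1 + (ci b).1,
            by have := (ri a).2; have := (ci b).2; omega⟩ : MvPolynomial (Fin n) K))}

lemma HI_le_ker {j t : ℕ} (E : Finset (Fin m)) (hE : E.card < t) :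
    HI K n j t ≤ RingHom.ker (phi K n E) := by
  rw [HI, Ideal.span_le]
  rintro d ⟨ri, ci, -, -, rfl⟩
  exact phi_hk E (by simpa using hE) (fun a => (ri a).1) (fun b => (ci b).1) _

lemma chain_or_cov (q : ℕ) : ∀ (s : Finset ℕ),
    (∃ a : Fin (q + 1) → ℕ, (∀ k l, k ≤ l → a k + 2 * l.1 ≤ a l + 2 * k.1) ∧ ∀ k, a k ∈ s) ∨
    (∃ i : Fin q → ℕ, ∀ x ∈ s, ∃ k, x = i k ∨ x = i k + 1) := by
  induction q with
  | zero =>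
    intro s
    rcases s.eq_empty_or_nonempty with rfl | ⟨x, hx⟩
    · right; exact ⟨fun _ => 0, by simp⟩
    · left
      refine ⟨fun _ => x, ?_, fun _ => hx⟩
      intro k l _
      have h1 : k = l := by ext; omega
      simp [h1]
  | succ q ih =>
    intro s
    rcases s.eq_empty_or_nonempty with rfl | hs
    · right; exact ⟨fun _ => 0, by simp⟩
    · set x := s.min' hs with hx
      have hxs : x ∈ s := s.min'_mem hs
      have hmin : ∀ y ∈ s, x ≤ y := fun y hy => s.min'_le y hy
      rcases ih (s.filter (fun y => x + 2 ≤ y)) with ⟨a, ha, has⟩ | ⟨i, hi⟩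
      · left
        simp only [Finset.mem_filter] at has
        refine ⟨Fin.cons x a, ?_, ?_⟩
        · intro k l
          refine Fin.cases ?_ (fun k => ?_) k
          · refine Fin.cases ?_ (fun l => ?_) l
            · simp
            · intro _
              have h1 := ha 0 l (Fin.zero_le _)
              have h2 := (has 0).2
              simp at h1 ⊢
              omega
          · refine Fin.cases ?_ (fun l => ?_) l
            · intro h
              exact absurd h (by simp)
            · intro h
              have h1 := ha k l (by simpa using h)
              simp
              omega
        · intro k
          refine Fin.cases ?_ (fun k => ?_) k
          · simpa using hxs
          · simpa using (has k).1
      · right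
        refine ⟨Fin.cons x i, fun y hy => ?_⟩
        by_cases hy2 : x + 2 ≤ y
        · obtain ⟨k, hk⟩ := hi y (Finset.mem_filter.2 ⟨hy, hy2⟩)
          exact ⟨k.succ, by simpa using hk⟩
        · refine ⟨0, ?_⟩
          have := hmin y hy
          simp only [Fin.cons_zero]
          omega

lemma wt_add (M N : Fin n →₀ ℕ) : wt (M + N) = wt M + wt N := by
  simp [wt, add_mul, Finset.sum_add_distrib]

lemma wt_single (c : Fin n) : wt (Finsupp.single c 1) = (c : ℕ) ^ 2 := by
  rw [wt, Finset.sum_eq_single c]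
  · simp
  · intro b _ hb; simp [hb.symm]
  · simp

lemma wt_sum {ι : Type*} (s : Finset ι) (f : ι → Fin n) :
    wt (∑ i ∈ s, Finsupp.single (f i) 1) = ∑ i ∈ s, (f i : ℕ) ^ 2 := by
  classical
  induction s using Finset.induction_on with
  | empty => simp [wt]
  | insert a s ha ih => rw [Finset.sum_insert ha, Finset.sum_insert ha, wt_add, ih, wt_single]

lemma hk_expand {t : ℕ} (r c : Fin t → ℕ) (h : ∀ a b, r a + c b < n) :
    hk K r c h = ∑ σ : Equiv.Perm (Fin t), (Equiv.Perm.sign σ : ℤ) •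
      monomial (∑ a, Finsupp.single (⟨r (σ a) + c a, h _ _⟩ : Fin n) 1) (1 : K) := by
  rw [hk, Matrix.det_apply]
  refine Finset.sum_congr rfl fun σ _ => ?_
  simp only [Matrix.of_apply, X, prod_monomial]
  simp [Units.smul_def]

lemma rearr {t : ℕ} (r c : Fin t → ℕ) (hr : StrictMono r) (hc : StrictMono c)
    (σ : Equiv.Perm (Fin t)) (hσ : σ ≠ 1) :
    ∑ a, (r (σ a) + c a) ^ 2 < ∑ a, (r a + c a) ^ 2 := by
  have hmv : Monovary r c := hr.monotone.monovary hc.monotone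
  have h1 := (hmv.sum_comp_perm_mul_lt_sum_mul_iff (σ := σ)).2 (by
    intro hm
    apply hσ
    have hmono : StrictMono σ := by
      intro a b hab
      have h1 : r (σ a) ≤ r (σ b) := hm (hc hab)
      have h2 : σ a ≤ σ b := hr.le_iff_le.1 h1
      exact lt_of_le_of_ne h2 (fun h => hab.ne (σ.injective h))
    ext a
    have h3 : (OrderIso.refl (Fin t)) = hmono.orderIsoOfSurjective σ σ.surjective := Subsingleton.elim _ _
    have := congrArg (fun f : Fin t ≃o Fin t => (f a : ℕ)) h3
    simpa using this.symm)
  have h2 : ∑ a, (r (σ a)) ^ 2 = ∑ a, (r a) ^ 2 := Equiv.sum_comp σ (fun a => (r a) ^ 2)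
  have e : ∀ x y : ℕ, (x + y) ^ 2 = x ^ 2 + y ^ 2 + 2 * (x * y) := fun x y => by ring
  simp only [e, Finset.sum_add_distrib, ← Finset.mul_sum, h2]
  omega

lemma monomial_red {j q : ℕ} (hq : q + 1 ≤ min j (n + 1 - j)) (E : Finset (Fin m))
    (hE : E.card = q) : ∀ (W : ℕ) (M : Fin n →₀ ℕ), wt M = W →
    (monomial M (1 : K)) ∈ (HI K n j (q + 1)).restrictScalars K ⊔
      restrictSupport K {N | Cov E N} := by
  intro W
  induction W using Nat.strong_induction_on with
  | _ W ih =>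
  intro M hM
  rcases chain_or_cov q (M.support.map Fin.valEmbedding) with ⟨a, ha, has⟩ | ⟨i, hi⟩
  · have ha2 : ∀ k, ∃ c : Fin n, M c ≠ 0 ∧ (c : ℕ) = a k := by
      intro k
      simpa using has k
    choose d hd hda using ha2
    have hlow : ∀ k : Fin (q + 1), 2 * k.1 ≤ a k := by
      intro k
      have := ha 0 k (Fin.zero_le _)
      simp at this
      omega
    have hup : ∀ k : Fin (q + 1), a k + 2 * q < n + 2 * k.1 := by
      intro k
      have := ha k (Fin.last q) (Fin.le_last _)
      have h2 := (d (Fin.last q)).2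
      rw [hda] at h2
      simp only [Fin.val_last] at this
      omega
    let r : Fin (q + 1) → ℕ := fun k => k.1 + min (a k - 2 * k.1) (j - (q + 1))
    let c : Fin (q + 1) → ℕ := fun k => a k - r k
    have hrj : ∀ k, r k < j := fun k => by
      have := k.2; simp only [r]; omega
    have hcj : ∀ k, c k < n + 1 - j := fun k => by
      have := k.2; have := hlow k; have := hup k
      simp only [c, r]; omega
    have hrc : ∀ k, r k + c k = a k := fun k => by
      have := hlow k
      simp only [c, r]; omega
    have hr : StrictMono r := by
      intro k l hkl
      have := ha k l hkl.le
      have := hlow k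
      have := hlow l
      have : k.1 < l.1 := hkl
      simp only [r]; omega
    have hc : StrictMono c := by
      intro k l hkl
      have := ha k l hkl.le
      have := hlow k
      have := hlow l
      have : k.1 < l.1 := hkl
      simp only [c, r]; omega
    have hlt : ∀ k l, r k + c l < n := fun k l => by
      have := hrj k; have := hcj l; omega
    have hmem : hk K r c hlt ∈ HI K n j (q + 1) := by
      apply Ideal.subset_span
      refine ⟨fun k => ⟨r k, hrj k⟩, fun k => ⟨c k, hcj k⟩, ?_, ?_, rfl⟩
      · intro k l hkl
        exact hr.injective (by simpa using hkl)
      · intro k l hkl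
        exact hc.injective (by simpa using hkl)
    set D : Fin n →₀ ℕ := ∑ k, Finsupp.single (d k) 1 with hD
    have hdinj : Function.Injective d := by
      intro k l hkl
      have h1 : a k = a l := by rw [← hda, ← hda, hkl]
      rcases le_total k l with h | h
      · have := ha k l h; ext; have : k.1 ≤ l.1 := h; omega
      · have := ha l k h; ext; have : l.1 ≤ k.1 := h; omega
    have hDM : D ≤ M := by
      intro x
      rw [hD, Finsupp.coe_finsetSum, Finset.sum_apply]
      by_cases hx : ∃ k, d k = x
      · obtain ⟨k, rfl⟩ := hx
        rw [Finset.sum_eq_single k]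
        · simp; have := hd k; omega
        · intro l _ hl; 
          rw [Finsupp.single_apply, if_neg (fun h => hl (hdinj h))]
        · simp
      · push Not at hx
        rw [Finset.sum_eq_zero]
        · simp
        · intro l _; rw [Finsupp.single_apply, if_neg (hx l)]
    have hd' : ∀ k, d k = ⟨r k + c k, hlt k k⟩ := fun k => by
      ext; simp [hrc, hda]
    have hexp := hk_expand (K := K) r c hlt
    rw [← Finset.add_sum_erase _ _ (Finset.mem_univ (1 : Equiv.Perm (Fin (q + 1))))] at hexp
    have hM2 : monomial M (1 : K) = monomial (M - D) 1 * hk K r c hlt -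
        ∑ σ ∈ Finset.univ.erase (1 : Equiv.Perm (Fin (q + 1))), (Equiv.Perm.sign σ : ℤ) •
      monomial (M - D + ∑ a, Finsupp.single (⟨r (σ a) + c a, hlt _ _⟩ : Fin n) 1) (1 : K) := by
      rw [hexp, mul_add, Finset.mul_sum]
      have e1 : ∀ N : Fin n →₀ ℕ, monomial (M - D + N) (1 : K) = monomial (M - D) 1 * monomial N 1 := by
        intro N; rw [monomial_mul, one_mul]
      simp only [e1, mul_smul_comm]
      rw [add_sub_cancel_right, Equiv.Perm.sign_one, Units.val_one, one_smul]
      simp only [Equiv.Perm.one_apply, ← hd']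
      rw [← hD, ← e1, tsub_add_cancel_of_le hDM]
    rw [hM2]
    refine sub_mem (Submodule.mem_sup_left ?_) (sum_mem fun σ hσ => ?_)
    · exact Ideal.mul_mem_left _ _ hmem
    · refine zsmul_mem ?_ _
      refine ih _ ?_ _ rfl
      rw [← hM, ← tsub_add_cancel_of_le hDM, tsub_add_cancel_of_le hDM, wt_add, hD, wt_sum]
      conv_rhs => rw [← tsub_add_cancel_of_le hDM, wt_add, hD, wt_sum]
      simp only [hd']
      have := rearr r c hr hc σ (Finset.ne_of_mem_erase hσ)
      omega
  · refine Submodule.mem_sup_right ?_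
    rw [mem_restrictSupport_iff]
    intro N hN
    have : N = M := by simpa using support_monomial_subset hN
    subst this
    let eqv : E ≃ Fin q := Fintype.equivFinOfCardEq (by simpa using hE)
    classical
    refine ⟨fun k => if h : k ∈ E then i (eqv ⟨k, h⟩) else 0, fun c hc => ?_⟩
    obtain ⟨k, hk⟩ := hi c (by simpa using ⟨c, hc, rfl⟩)
    refine ⟨(eqv.symm k).1, (eqv.symm k).2, ?_⟩
    simpa using hk

theorem HI_eq_ker [CharZero K] {j q : ℕ} (hq : q + 1 ≤ min j (n + 1 - j)) (E : Finset (Fin m))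
    (hE : E.card = q) : HI K n j (q + 1) = RingHom.ker (phi K n E) := by
  refine le_antisymm (HI_le_ker E (by omega)) ?_
  intro f hf
  have hf2 : f ∈ (HI K n j (q + 1)).restrictScalars K ⊔ restrictSupport K {N | Cov E N} := by
    rw [f.as_sum]
    refine sum_mem fun N _ => ?_
    have := Submodule.smul_mem _ (f.coeff N) (monomial_red (K := K) hq E hE _ N rfl)
    rwa [smul_monomial, smul_eq_mul, mul_one] at this
  obtain ⟨g, hg, h, hh, rfl⟩ := Submodule.mem_sup.1 hf2
  have hg' : g ∈ HI K n j (q + 1) := hg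
  have h0 : phi K n E h = 0 := by
    have := HI_le_ker E (by omega) hg'
    rw [RingHom.mem_ker] at this hf
    rw [map_add, this, zero_add] at hf
    exact hf
  have : h = 0 := by
    by_contra hne
    exact phi_ne_zero E h hne (fun N hN => (mem_restrictSupport_iff _).1 hh hN) h0
  rwa [this, add_zero]


lemma mem_symb {R : Type*} [CommRing R] [IsNoetherianRing R] (I : Ideal R) [hI : I.IsPrime]
    (s : ℕ) (f : R) : f ∈ symbolicPower I s ↔ ∃ g, g ∉ I ∧ g * f ∈ I ^ s := by
  have hA : associatedPrimes R (R ⧸ I) = {I} := by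
    rw [associatedPrimes.eq_singleton_of_isPrimary hI.isPrimary, hI.radical]
  have hmem : ∀ p : Ideal R, p ∈ associatedPrimes R (R ⧸ I) ↔ p = I := by
    intro p; rw [hA]; rfl
  have key : ∀ (p : Ideal R) (hp : p.IsPrime), p = I → (f ∈ Ideal.comap (algebraMap R (Localization.AtPrime p))
      (Ideal.map (algebraMap R (Localization.AtPrime p)) (I ^ s)) ↔ ∃ g, g ∉ I ∧ g * f ∈ I ^ s) := by
    rintro p hp rfl
    rw [Ideal.mem_comap, IsLocalization.algebraMap_mem_map_algebraMap_iff p.primeCompl]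
    rfl
  rw [symbolicPower, Ideal.mem_iInf]
  constructor
  · intro h
    exact (key I hI rfl).1 (h ⟨I, (hmem I).2 rfl⟩)
  · intro h p
    exact (key p.1 p.2.isPrime ((hmem p.1).1 p.2)).2 h

section lower

noncomputable def tau {L : Type*} [CommRing L] (S : Finset (Fin m)) :
    MvPolynomial (Fin m) L →ₐ[L] Polynomial (MvPolynomial (Fin m) L) :=
  aeval (fun k => if k ∈ S then Polynomial.C (X k) * Polynomial.X else Polynomial.C (X k))

lemma tau_monomial {L : Type*} [CommRing L] (S : Finset (Fin m)) (a : Fin m →₀ ℕ) (r : L) :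
    tau S (monomial a r) = Polynomial.C (monomial a r) * Polynomial.X ^ (∑ k ∈ S, a k) := by
  rw [tau, aeval_monomial, Finsupp.prod_fintype _ _ (by simp)]
  have : ∀ k, (if k ∈ S then Polynomial.C (X k : MvPolynomial (Fin m) L) * Polynomial.X
      else Polynomial.C (X k)) ^ a k =
      Polynomial.C (X k ^ a k) * (if k ∈ S then Polynomial.X ^ a k else 1) := by
    intro k
    split_ifs <;> simp [mul_pow]
  simp only [this, Finset.prod_mul_distrib]
  rw [Finset.prod_ite_mem, Finset.univ_inter, Finset.prod_pow_eq_pow_sum, ← mul_assoc]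
  congr 1
  rw [← map_prod, monomial_eq, Finsupp.prod_fintype _ _ (by simp), Polynomial.C_mul]
  rfl

lemma coeff_tau {L : Type*} [CommRing L] (S : Finset (Fin m)) (h : MvPolynomial (Fin m) L)
    (a : Fin m →₀ ℕ) : coeff a ((tau S h).coeff (∑ k ∈ S, a k)) = coeff a h := by
  conv_lhs => rw [h.as_sum]
  rw [map_sum, Polynomial.finsetSum_coeff, coeff_sum]
  conv_rhs => rw [h.as_sum, coeff_sum]
  refine Finset.sum_congr rfl fun b _ => ?_
  rw [tau_monomial, Polynomial.coeff_C_mul, Polynomial.coeff_X_pow]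
  by_cases hab : b = a
  · subst hab; simp
  · split_ifs <;> simp [hab]

lemma tau_phi (S : Finset (Fin m)) (g : MvPolynomial (Fin n) K) :
    (tau S (phi K n Finset.univ g)).coeff 0 = phi K n Sᶜ g := by
  have : ((Polynomial.evalRingHom (0 : MvPolynomial (Fin m) (MvPolynomial (Fin m) K))).comp
      (tau (L := MvPolynomial (Fin m) K) S).toRingHom).comp
        (phi K n Finset.univ).toRingHom = (phi K n Sᶜ).toRingHom := by
    refine MvPolynomial.ringHom_ext ?_ ?_
    · intro r
      simp [phi, tau, MvPolynomial.algebraMap_apply, Polynomial.algebraMap_apply]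
    · intro c
      simp only [AlgHom.toRingHom_eq_coe, RingHom.coe_comp, RingHom.coe_coe, Function.comp_apply,
        phi, aeval_X, map_sum, map_mul, tau, algHom_C, Polynomial.algebraMap_apply,
        MvPolynomial.algebraMap_eq]
      rw [← Finset.sum_subset (Finset.subset_univ Sᶜ)]
      · refine Finset.sum_congr rfl fun k hk => ?_
        rw [if_neg (Finset.mem_compl.1 hk)]
        simp
      · intro k _ hk
        rw [if_pos (by simpa using hk)]
        simp
  have h2 := congrArg (fun F => F g) this
  simpa [Polynomial.coeff_zero_eq_eval_zero] using h2

lemma lower_aux [CharZero K] {j q s : ℕ} (hq : q + 1 ≤ min j (n + 1 - j)) (S : Finset (Fin m))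
    (hS : Sᶜ.card = q) (f g : MvPolynomial (Fin n) K) (hg : g ∉ HI K n j (q + 1))
    (hgf : g * f ∈ HI K n j (q + 1) ^ s) (a : Fin m →₀ ℕ)
    (ha : coeff a (phi K n Finset.univ f) ≠ 0) : s ≤ ∑ k ∈ S, a k := by
  set Ψ : MvPolynomial (Fin n) K →+* Polynomial (MvPolynomial (Fin m) (MvPolynomial (Fin m) K)) :=
    (tau (L := MvPolynomial (Fin m) K) S).toRingHom.comp (phi K n Finset.univ).toRingHom with hΨ
  have hker : ∀ h, Polynomial.X ∣ Ψ h ↔ h ∈ HI K n j (q + 1) := by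
    intro h
    rw [HI_eq_ker hq Sᶜ hS, RingHom.mem_ker, Polynomial.X_dvd_iff, ← tau_phi]
    rfl
  have h1 : (HI K n j (q + 1)).map Ψ ≤ Ideal.span {Polynomial.X} := by
    rw [Ideal.map_le_iff_le_comap]
    intro h hh
    rw [Ideal.mem_comap, Ideal.mem_span_singleton]
    exact (hker h).2 hh
  have h2 : Polynomial.X ^ s ∣ Ψ (g * f) := by
    rw [← Ideal.mem_span_singleton, ← Ideal.span_singleton_pow]
    apply Ideal.pow_right_mono h1 s
    rw [← Ideal.map_pow]
    exact Ideal.mem_map_of_mem _ hgf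
  rw [map_mul] at h2
  have h3 := Polynomial.prime_X.pow_dvd_of_dvd_mul_left s (fun h => hg ((hker g).1 h)) h2
  rw [Polynomial.X_pow_dvd_iff] at h3
  by_contra hlt
  push Not at hlt
  apply ha
  rw [← coeff_tau S]
  have := h3 _ hlt
  have h4 : Ψ f = tau S (phi K n Finset.univ f) := rfl
  rw [← h4, this, coeff_zero]

lemma comb {c k l s : ℕ} (a : Fin m → ℕ) (hc : c ≤ m) (hl : l < c) (hk : 1 ≤ k)
    (hs : s + l = k * c)
    (h : ∀ S : Finset (Fin m), S.card = c → s ≤ ∑ x ∈ S, a x) : k * m ≤ ∑ x, a x + l := by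
  obtain ⟨S, hS, hmin⟩ := Finset.exists_min_image (Finset.powersetCard c (Finset.univ : Finset (Fin m)))
    (fun S => ∑ x ∈ S, a x) (Finset.powersetCard_nonempty.2 (by simpa using hc))
  have hSc : S.card = c := (Finset.mem_powersetCard.1 hS).2
  have hne : S.Nonempty := Finset.card_pos.1 (by omega)
  obtain ⟨x, hx, hmax⟩ := Finset.exists_max_image S a hne
  have hsum := h S hSc
  have hax : k ≤ a x := by
    by_contra hlt
    have h1 : ∑ y ∈ S, a y ≤ S.card • (k - 1) :=
      Finset.sum_le_card_nsmul _ _ _ (fun y hy => by have := hmax y hy; omega)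
    rw [hSc, smul_eq_mul] at h1
    obtain ⟨k', rfl⟩ : ∃ k', k = k' + 1 := ⟨k - 1, by omega⟩
    simp only [Nat.add_sub_cancel] at h1
    nlinarith
  have hout : ∀ y ∈ Sᶜ, k ≤ a y := by
    intro y hy
    have hy' : y ∉ S := Finset.mem_compl.1 hy
    have hy2 : y ∉ S.erase x := fun h => hy' (Finset.mem_of_mem_erase h)
    have h1 := hmin (insert y (S.erase x)) (by
      rw [Finset.mem_powersetCard]
      refine ⟨Finset.subset_univ _, ?_⟩
      rw [Finset.card_insert_of_notMem hy2, Finset.card_erase_of_mem hx]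
      omega)
    simp only [Finset.sum_insert hy2] at h1
    have h2 := Finset.add_sum_erase S a hx
    omega
  have h3 := Finset.card_nsmul_le_sum Sᶜ a k hout
  rw [Finset.card_compl, Fintype.card_fin, hSc, smul_eq_mul] at h3
  have h4 := Finset.sum_add_sum_compl S a
  obtain ⟨d, rfl⟩ := Nat.exists_eq_add_of_le hc
  rw [Nat.add_sub_cancel_left] at h3
  nlinarith

end lower

lemma phi_homog (E : Finset (Fin m)) {f : MvPolynomial (Fin n) K} {d : ℕ} (hf : f.IsHomogeneous d) :
    (phi K n E f).IsHomogeneous d := by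
  have := hf.aeval (fun c : Fin n => ∑ k ∈ E, (X k * C (X k ^ (c : ℕ)) :
    MvPolynomial (Fin m) (MvPolynomial (Fin m) K))) (n := 1) (fun c => by
      refine IsHomogeneous.sum _ _ _ fun k _ => ?_
      exact (isHomogeneous_X _ k).mul (isHomogeneous_C _ _))
  rwa [one_mul] at this

lemma phi_inj [CharZero K] (hm : n ≤ 2 * m) (f : MvPolynomial (Fin n) K) (hf : f ≠ 0) :
    phi K n (Finset.univ : Finset (Fin m)) f ≠ 0 := by
  refine phi_ne_zero _ f hf fun N _ => ⟨fun k => 2 * k.1, fun c _ => ?_⟩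
  have := c.2
  refine ⟨⟨c.1 / 2, by omega⟩, Finset.mem_univ _, ?_⟩
  simp only
  omega

lemma HI_prime [CharZero K] {j q : ℕ} (hq : q + 1 ≤ min j (n + 1 - j)) :
    (HI K n j (q + 1)).IsPrime := by
  rw [HI_eq_ker (m := q) hq Finset.univ (by simp)]
  exact RingHom.ker_isPrime _

theorem lower [CharZero K] {j q k l s d : ℕ} (hq : q + 1 ≤ min j (n + 1 - j)) (hm : m = (n + 1) / 2)
    (hk : 1 ≤ k) (hl : l < m - q) (hs : s + l = k * (m - q)) (f : MvPolynomial (Fin n) K)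
    (hf : f ∈ symbolicPower (HI K n j (q + 1)) s) (hf0 : f ≠ 0) (hd : f.IsHomogeneous d) :
    k * m ≤ d + l := by
  have := HI_prime (K := K) hq
  obtain ⟨g, hg, hgf⟩ := (mem_symb _ s f).1 hf
  have h0 := phi_inj (m := m) (by omega) f hf0
  obtain ⟨a, ha⟩ := MvPolynomial.ne_zero_iff.1 h0
  have hdeg := phi_homog (Finset.univ : Finset (Fin m)) hd ha
  have hsum : ∑ x, a x = d := by
    rw [← hdeg]
    simp [Finsupp.weight_apply, Finsupp.sum_fintype]
  rw [← hsum]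
  refine comb (c := m - q) (s := s) a (by omega) hl hk hs fun S hS => ?_
  exact lower_aux hq S (by rw [Finset.card_compl, Fintype.card_fin, hS]; omega) f g hg hgf a ha

section upper

lemma schur {A ι κ : Type*} [CommRing A] [Fintype ι] [DecidableEq ι] [Fintype κ] [DecidableEq κ]
    (P : Matrix ι ι A) (B : Matrix ι κ A) (C : Matrix κ ι A) (D : Matrix κ κ A) :
    P.det ^ (Fintype.card κ) * (Matrix.fromBlocks P B C D).det =
      P.det * (P.det • D - C * P.adjugate * B).det := by
  have h : Matrix.fromBlocks 1 0 (-(C * P.adjugate)) (P.det • (1 : Matrix κ κ A)) *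
      Matrix.fromBlocks P B C D = Matrix.fromBlocks P B 0 (P.det • D - C * P.adjugate * B) := by
    rw [Matrix.fromBlocks_multiply]
    congr 1
    · simp
    · simp
    · rw [Matrix.neg_mul, Matrix.mul_assoc, Matrix.adjugate_mul]
      simp
    · rw [Matrix.neg_mul, Matrix.smul_mul, Matrix.one_mul, sub_eq_add_neg, add_comm]
  have h2 := congrArg Matrix.det h
  rw [Matrix.det_mul, Matrix.det_fromBlocks_zero₁₂, Matrix.det_fromBlocks_zero₂₁] at h2
  simpa [Matrix.det_smul] using h2

lemma det_mem_pow {A κ : Type*} [CommRing A] [Fintype κ] [DecidableEq κ] (I : Ideal A)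
    (M : Matrix κ κ A) (h : ∀ a b, M a b ∈ I) : M.det ∈ I ^ (Fintype.card κ) := by
  rw [Matrix.det_apply]
  refine sum_mem fun σ _ => ?_
  rw [Units.smul_def]
  refine zsmul_mem ?_ _
  have := Ideal.prod_mem_prod (s := (Finset.univ : Finset κ)) (I := fun _ => I)
    (x := fun i => M (σ i) i) (fun i _ => h _ _)
  simpa using this

noncomputable def DD (K : Type*) [Field K] (n q : ℕ) (h : 2 * q ≤ n + 1) : MvPolynomial (Fin n) K :=
  hk K (fun a : Fin q => a.1) (fun a : Fin q => a.1) (fun a b => by omega)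

lemma hk_equiv {τ τ' : Type*} [Fintype τ] [DecidableEq τ] [Fintype τ'] [DecidableEq τ']
    (e : τ' ≃ τ) (r c : τ → ℕ) (h : ∀ a b, r a + c b < n) :
    hk K r c h = hk K (r ∘ e) (c ∘ e) (fun _ _ => h _ _) := by
  rw [hk, ← Matrix.det_submatrix_equiv_self e]
  rfl

lemma DD_ne_zero (q : ℕ) (h : 2 * q ≤ n + 1) : DD K n q h ≠ 0 := by
  intro h0
  have h1 := congrArg (MvPolynomial.eval (fun c : Fin n => if c.1 + 1 = q then (1 : K) else 0)) h0
  rw [DD, hk, RingHom.map_det, map_zero] at h1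
  have h2 : (MvPolynomial.eval (fun c : Fin n => if c.1 + 1 = q then (1 : K) else 0)).mapMatrix
      (Matrix.of fun a b : Fin q => (X ⟨a.1 + b.1, by omega⟩ : MvPolynomial (Fin n) K)) =
      Equiv.Perm.permMatrix K (Fin.revPerm : Equiv.Perm (Fin q)) := by
    ext a b
    have : (a.1 + b.1 + 1 = q) ↔ (Fin.rev a = b) := by
      rw [Fin.ext_iff, Fin.val_rev]; omega
    simp [Equiv.Perm.permMatrix, PEquiv.toMatrix_apply, this]
  rw [h2, Matrix.det_permutation] at h1
  rcases Int.units_eq_one_or (Equiv.Perm.sign (Fin.revPerm : Equiv.Perm (Fin q))) with h | h <;>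
    simp [h] at h1

lemma DD_homog (q : ℕ) (h : 2 * q ≤ n + 1) : (DD K n q h).IsHomogeneous q := by
  rw [DD, hk_expand, ← mem_homogeneousSubmodule]
  refine sum_mem fun σ _ => zsmul_mem ?_ _
  rw [mem_homogeneousSubmodule]
  apply isHomogeneous_monomial
  simp

lemma DD_notMem [CharZero K] (q : ℕ) (h : 2 * q ≤ n + 1) :
    phi K n (Finset.univ : Finset (Fin q)) (DD K n q h) ≠ 0 := by
  have hc : DD K n q h ∈ restrictSupport K {N | Cov (Finset.univ : Finset (Fin q)) N} := by
    rw [DD, hk_expand]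
    refine sum_mem fun σ _ => zsmul_mem ?_ _
    rw [mem_restrictSupport_iff]
    intro N hN
    have hN2 := support_monomial_subset hN
    rw [Finset.mem_singleton] at hN2
    refine ⟨fun k => 2 * k.1, fun c hc => ?_⟩
    rw [hN2, Finsupp.coe_finsetSum, Finset.sum_apply] at hc
    obtain ⟨a, -, ha⟩ := Finset.exists_ne_zero_of_sum_ne_zero hc
    have hca : c.1 = (σ a).1 + a.1 := by
      by_contra hne
      apply ha
      rw [Finsupp.single_apply, if_neg]
      intro h
      exact hne (by rw [← h])
    have := (σ a).2
    refine ⟨⟨c.1 / 2, by omega⟩, Finset.mem_univ _, ?_⟩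
    simp only
    omega
  exact phi_ne_zero _ _ (DD_ne_zero q h) fun N hN => (mem_restrictSupport_iff _).1 hc hN

theorem DD_mem [CharZero K] {j q : ℕ} (hq : q + 1 ≤ min j (n + 1 - j)) (e : ℕ)
    (h : 2 * (q + e) ≤ n + 1) :
    ∃ g, g ∉ HI K n j (q + 1) ∧ g * DD K n (q + e) h ∈ HI K n j (q + 1) ^ e := by
  have hprime := HI_prime (K := K) hq
  have hker := HI_eq_ker (K := K) (m := q) hq Finset.univ (by simp)
  have hδ : DD K n q (by omega) ∉ HI K n j (q + 1) := by
    rw [hker, RingHom.mem_ker]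
    exact DD_notMem q _
  set δ := DD K n q (by omega) with hδd
  let P : Matrix (Fin q) (Fin q) (MvPolynomial (Fin n) K) :=
    Matrix.of fun a b => X ⟨a.1 + b.1, by omega⟩
  let B : Matrix (Fin q) (Fin e) (MvPolynomial (Fin n) K) :=
    Matrix.of fun a b => X ⟨a.1 + (q + b.1), by omega⟩
  let C' : Matrix (Fin e) (Fin q) (MvPolynomial (Fin n) K) :=
    Matrix.of fun a b => X ⟨(q + a.1) + b.1, by omega⟩
  let D : Matrix (Fin e) (Fin e) (MvPolynomial (Fin n) K) :=
    Matrix.of fun a b => X ⟨(q + a.1) + (q + b.1), by omega⟩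
  have hP : P.det = δ := rfl
  have hDD : DD K n (q + e) h = (Matrix.fromBlocks P B C' D).det := by
    rw [DD, hk_equiv finSumFinEquiv, hk]
    congr 1
    ext1 a b
    rcases a with a | a <;> rcases b with b | b <;> rfl
  have hF : ∀ a b, (P.det • D - C' * P.adjugate * B) a b ∈ HI K n j (q + 1) := by
    intro a b
    have h1 := schur P (B.submatrix id (fun _ : Fin 1 => b)) (C'.submatrix (fun _ : Fin 1 => a) id)
      (D.submatrix (fun _ : Fin 1 => a) (fun _ : Fin 1 => b))
    have h2 : (Matrix.fromBlocks P (B.submatrix id (fun _ : Fin 1 => b))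
        (C'.submatrix (fun _ : Fin 1 => a) id)
        (D.submatrix (fun _ : Fin 1 => a) (fun _ : Fin 1 => b))).det ∈ HI K n j (q + 1) := by
      rw [hker, RingHom.mem_ker]
      have h3 := phi_hk (K := K) (n := n) (Finset.univ : Finset (Fin q)) (τ := Fin q ⊕ Fin 1) (by simp)
        (Sum.elim (fun x => x.1) (fun _ => q + a.1)) (Sum.elim (fun x => x.1) (fun _ => q + b.1))
        (by rintro (x | x) (y | y) <;> simp <;> omega)
      rw [hk] at h3
      convert h3 using 3
      ext1 x y
      rcases x with x | x <;> rcases y with y | y <;> rfl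
    have h4 : P.det * (P.det • D - C' * P.adjugate * B) a b ∈ HI K n j (q + 1) := by
      have h5 : (P.det • (D.submatrix (fun _ : Fin 1 => a) (fun _ : Fin 1 => b)) -
        (C'.submatrix (fun _ : Fin 1 => a) id) * P.adjugate *
          (B.submatrix id (fun _ : Fin 1 => b))).det = (P.det • D - C' * P.adjugate * B) a b := by
        rw [Matrix.det_fin_one]
        simp [Matrix.mul_apply]
      rw [← h5, ← h1]
      exact Ideal.mul_mem_left _ _ h2
    exact (hprime.mem_or_mem h4).resolve_left (by rwa [hP])
  refine ⟨δ ^ e, fun hmem => hδ (hprime.mem_of_pow_mem _ hmem), ?_⟩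
  have h6 := schur P B C' D
  rw [Fintype.card_fin, hP] at h6
  rw [hDD, h6]
  apply Ideal.mul_mem_left
  have := det_mem_pow _ _ hF
  rwa [Fintype.card_fin, hP] at this

theorem upper [CharZero K] {j q k l s : ℕ} (hq : q + 1 ≤ min j (n + 1 - j)) (hm : m = (n + 1) / 2)
    (hk : 1 ≤ k) (hl : l < m - q) (hs : s + l = k * (m - q)) :
    ∃ f ∈ symbolicPower (HI K n j (q + 1)) s, f ≠ 0 ∧ f.IsHomogeneous (k * m - l) := by
  have hprime := HI_prime (K := K) hq
  obtain ⟨g1, hg1, hm1⟩ := DD_mem (K := K) hq (m - q) (by omega)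
  obtain ⟨g2, hg2, hm2⟩ := DD_mem (K := K) hq (m - q - l) (by omega)
  set D1 := DD K n (q + (m - q)) (by omega) with hD1
  set D2 := DD K n (q + (m - q - l)) (by omega) with hD2
  obtain ⟨k', rfl⟩ : ∃ k', k = k' + 1 := ⟨k - 1, by omega⟩
  refine ⟨D1 ^ k' * D2, ?_, ?_, ?_⟩
  · rw [mem_symb]
    refine ⟨g1 ^ k' * g2, ?_, ?_⟩
    · intro h
      rcases hprime.mem_or_mem h with h | h
      · exact hg1 (hprime.mem_of_pow_mem _ h)
      · exact hg2 h
    · have e1 : g1 ^ k' * g2 * (D1 ^ k' * D2) = (g1 * D1) ^ k' * (g2 * D2) := by ring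
      have e2 : s = (m - q) * k' + (m - q - l) := by
        rw [add_mul, mul_comm k'] at hs; omega
      rw [e1, e2, pow_add, pow_mul]
      exact Ideal.mul_mem_mul (Ideal.pow_mem_pow hm1 _) hm2
  · exact mul_ne_zero (pow_ne_zero _ (DD_ne_zero _ _)) (DD_ne_zero _ _)
  · have h1 := ((DD_homog (K := K) (n := n) (q + (m - q)) (by omega)).pow k').mul
      (DD_homog (K := K) (n := n) (q + (m - q - l)) (by omega))
    convert h1 using 1
    have : q + (m - q) = m := by omega
    rw [this, add_mul, mul_comm k']
    omega

end upper

theorem alpha_eq [CharZero K] {j q k l s : ℕ} (hq : q + 1 ≤ min j (n + 1 - j)) (hm : m = (n + 1) / 2)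
    (hk : 1 ≤ k) (hl : l < m - q) (hs : s + l = k * (m - q)) :
    alphaDeg (symbolicPower (HI K n j (q + 1)) s) = k * m - l := by
  have hu := upper (K := K) hq hm hk hl hs
  apply le_antisymm
  · exact Nat.sInf_le hu
  · refine le_csInf ⟨_, hu⟩ ?_
    rintro d ⟨f, hf, hf0, hd⟩
    have := lower hq hm hk hl hs f hf hf0 hd
    omega

theorem waldschmidt [CharZero K] {j q : ℕ} (hq : q + 1 ≤ min j (n + 1 - j)) (hm : m = (n + 1) / 2) :
    Tendsto (fun s : ℕ => (alphaDeg (symbolicPower (HI K n j (q + 1)) s) : ℝ) / s) atTop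
      (nhds ((m : ℝ) / ((m : ℝ) - q))) := by
  obtain ⟨c, hc⟩ : ∃ c, m = q + c := ⟨m - q, by omega⟩
  have hc0 : 0 < c := by omega
  have hmq : (m : ℝ) - q = c := by rw [hc]; push_cast; ring
  have hcR : (0 : ℝ) < c := by exact_mod_cast hc0
  have hb : ∀ s : ℕ, 1 ≤ s →
      s * m ≤ c * alphaDeg (symbolicPower (HI K n j (q + 1)) s) ∧
      c * alphaDeg (symbolicPower (HI K n j (q + 1)) s) ≤ s * m + q * c := by
    intro s hs
    obtain ⟨k, l, hk, hl, hkl⟩ : ∃ k l, 1 ≤ k ∧ l < c ∧ s + l = k * c := by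
      refine ⟨(s - 1) / c + 1, c - 1 - (s - 1) % c, Nat.le_add_left _ _, by omega, ?_⟩
      have h1 := Nat.div_add_mod (s - 1) c
      have h2 := Nat.mod_lt (s - 1) hc0
      rw [add_mul, mul_comm _ c]
      omega
    have hcm : c = m - q := by omega
    rw [alpha_eq hq hm hk (hcm ▸ hl) (hcm ▸ hkl)]
    have h3 : k * m - l = s + k * q := by
      rw [hc, mul_add]; omega
    rw [h3, hc]
    constructor
    · nlinarith
    · nlinarith
  rw [hmq]
  have hlim : Tendsto (fun s : ℕ => (m : ℝ) / c + (q : ℝ) / s) atTop (nhds ((m : ℝ) / c)) := by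
    have := (tendsto_const_div_atTop_nhds_zero_nat (q : ℝ)).const_add ((m : ℝ) / c)
    simpa using this
  refine tendsto_of_tendsto_of_tendsto_of_le_of_le' tendsto_const_nhds hlim ?_ ?_
  · filter_upwards [eventually_ge_atTop 1] with s hs
    have hsR : (0 : ℝ) < s := by exact_mod_cast hs
    rw [div_le_div_iff₀ hcR hsR]
    have := (hb s hs).1
    have : (s : ℝ) * m ≤ c * alphaDeg (symbolicPower (HI K n j (q + 1)) s) := by exact_mod_cast this
    linarith
  · filter_upwards [eventually_ge_atTop 1] with s hs
    have hsR : (0 : ℝ) < s := by exact_mod_cast hs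
    rw [div_add_div _ _ hcR.ne' hsR.ne', div_le_div_iff₀ hsR (by positivity)]
    have := (hb s hs).2
    have : (c : ℝ) * alphaDeg (symbolicPower (HI K n j (q + 1)) s) ≤ s * m + q * c := by
      exact_mod_cast this
    nlinarith

end HankelAux

/-- Theorem 4.6(1): let `X_j` be the `j × (n+1-j)` Hankel matrix in the variables
`x_1, …, x_n` (its `(a,b)` entry, with `a, b` zero-indexed, is `x_{a+b}` zero-indexed, i.e.
`x_{a+b-1}` one-indexed), `I_t(X_j)` the ideal of its `t × t` minors, and `m = ⌊(n+1)/2⌋`.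
Then `α(I_t(X_j)^{(k(m-t+1)-l)}) = km - l` for `k ≥ 1` and `0 ≤ l ≤ m - t`, and the
Waldschmidt constant of `I_t(X_j)` equals `m/(m-t+1)`. -/
theorem hankel_alpha_waldschmidt {K : Type*} [Field K] [CharZero K]
    (n j t : ℕ) (hj : j ≤ n) (ht1 : 1 ≤ t) (ht : t ≤ min j (n + 1 - j)) :
    let m : ℕ := (n + 1) / 2
    let I : Ideal (MvPolynomial (Fin n) K) := Ideal.span {d |
      ∃ (ri : Fin t → Fin j) (ci : Fin t → Fin (n + 1 - j)),
        Function.Injective ri ∧ Function.Injective ci ∧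
        d = Matrix.det (Matrix.of fun a b =>
          (MvPolynomial.X ⟨(ri a).1 + (ci b).1,
            by have := (ri a).2; have := (ci b).2; omega⟩ : MvPolynomial (Fin n) K))}
    (∀ k l : ℕ, 1 ≤ k → l ≤ m - t →
      alphaDeg (symbolicPower I (k * (m - t + 1) - l)) = k * m - l) ∧
    Tendsto (fun s : ℕ => (alphaDeg (symbolicPower I s) : ℝ) / s) atTop
      (nhds ((m : ℝ) / ((m : ℝ) - t + 1))) := by
  obtain ⟨q, rfl⟩ : ∃ q, t = q + 1 := ⟨t - 1, by omega⟩
  intro m I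
  have hm : m = (n + 1) / 2 := rfl
  have hI : I = HankelAux.HI K n j (q + 1) := rfl
  have hqm : q + 1 ≤ m := by omega
  clear_value m I
  subst hI
  have hmq : m - (q + 1) + 1 = m - q := by omega
  refine ⟨fun k l hk hl => ?_, ?_⟩
  · rw [hmq]
    have hle : l ≤ k * (m - q) := by
      have : 1 * (m - q) ≤ k * (m - q) := Nat.mul_le_mul_right _ hk
      omega
    exact HankelAux.alpha_eq ht hm hk (by omega) (Nat.sub_add_cancel hle)
  · have h := HankelAux.waldschmidt (K := K) ht hm
    have e : (m : ℝ) - ((q + 1 : ℕ) : ℝ) + 1 = (m : ℝ) - q := by push_cast; ring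
    rw [e]
    exact h
end

section
/- Let k be a field of characteristic zero, R = k[x_1,…,x_n] with homogeneous maximal ideal 𝔪 = (x_1,…,x_n), and for j ≤ n let X_j be the j×(n+1−j) Hankel matrix whose (a,b)-entry is x_{a+b−1}. For 1 ≤ t ≤ min{j, n+1−j} let I_t(X_j) be the ideal generated by all t×t minors of X_j, and set m := ⌊(n+1)/2⌋. Then for every non-negative integer N, the resurgence and asymptotic resurgence of the pair of families (I_t(X_j)^{(•)}, (𝔪^N I_t(X_j))^•) both equal (N+t)(m−t+1)/m; that is, sup{ s/r : s, r positive integers, I_t(X_j)^{(s)} ⊄ 𝔪^{Nr} I_t(X_j)^r } = sup{ s/r : I_t(X_j)^{(sT)} ⊄ 𝔪^{NrT} I_t(X_j)^{rT} for all sufficiently large T } = (N+t)(m−t+1)/m. -/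
open MvPolynomial Filter

/-- The resurgence of a pair of families of ideals:
`ρ(a_•, b_•) = sup { s/r : a_s ⊄ b_r }`. -/
noncomputable def resurgencePair {R : Type*} [CommRing R] (a b : ℕ → Ideal R) : ℝ :=
  sSup {x : ℝ | ∃ s r : ℕ, 0 < s ∧ 0 < r ∧ x = (s : ℝ) / r ∧ ¬ a s ≤ b r}

/-- The asymptotic resurgence of a pair of families of ideals:
`ρ̂(a_•, b_•) = sup { s/r : a_{sT} ⊄ b_{rT} for all T ≫ 0 }`. -/
noncomputable def asympResurgencePair {R : Type*} [CommRing R] (a b : ℕ → Ideal R) : ℝ :=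
  sSup {x : ℝ | ∃ s r : ℕ, 0 < s ∧ 0 < r ∧ x = (s : ℝ) / r ∧
    ∀ᶠ T in atTop, ¬ a (s * T) ≤ b (r * T)}


namespace HankelRes

/-! ### Combinatorics -/

/-- Least total weight among the first `k` indices left uncovered by `p` adjacent pairs. -/
def cov (α : ℕ → ℕ) : ℕ → ℕ → ℕ
  | 0, _ => 0
  | 1, 0 => α 0
  | 1, _ + 1 => 0
  | k + 2, 0 => cov α (k + 1) 0 + α (k + 1)
  | k + 2, p + 1 => min (cov α (k + 1) (p + 1) + α (k + 1)) (cov α k p)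

theorem interlace_step (g h g' : ℕ → ℕ) (a : ℕ)
    (hA : ∀ p, h p + g (p + 1) ≤ g p + h (p + 1))
    (hB : ∀ p, g (p + 1) + h (p + 1) ≤ h p + g (p + 1 + 1))
    (h0 : g' 0 = g 0 + a) (h1 : ∀ p, g' (p + 1) = min (g (p + 1) + a) (h p)) :
    (∀ p, g p + g' (p + 1) ≤ g' p + g (p + 1)) ∧
    (∀ p, g' (p + 1) + g (p + 1) ≤ g p + g' (p + 1 + 1)) := by
  constructor
  · intro p
    cases p with
    | zero => rw [h0, h1]; have := hA 0; simp only [zero_add] at *; omega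
    | succ p => rw [h1, h1]; have := hB p; omega
  · intro p
    rw [h1, h1]; have := hA p; have := hB p; have := hA (p + 1); omega

theorem cov_interlace (α : ℕ → ℕ) (k : ℕ) :
    (∀ p, cov α k p + cov α (k + 1) (p + 1) ≤ cov α (k + 1) p + cov α k (p + 1)) ∧
    (∀ p, cov α (k + 1) (p + 1) + cov α k (p + 1) ≤ cov α k p + cov α (k + 1) (p + 1 + 1)) := by
  induction k with
  | zero =>
    constructor
    · intro p; cases p <;> simp [cov]
    · intro p; simp [cov]
  | succ k ih =>
    exact interlace_step (cov α (k + 1)) (cov α k) (cov α (k + 1 + 1)) (α (k + 1)) ih.1 ih.2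
      rfl (fun p => rfl)

theorem cov_mono (α : ℕ → ℕ) (k : ℕ) : ∀ p, cov α k (p + 1) ≤ cov α k p := by
  induction k using Nat.strong_induction_on with
  | _ k ih =>
    intro p
    match k, p with
    | 0, _ => simp [cov]
    | 1, 0 => simp [cov]
    | 1, p + 1 => simp [cov]
    | k + 2, 0 =>
      have := ih (k + 1) (by omega) 0
      simp only [cov]; omega
    | k + 2, p + 1 =>
      have := ih (k + 1) (by omega) (p + 1)
      have := ih k (by omega) p
      have h1 : cov α (k + 2) (p + 1) =
          min (cov α (k + 1) (p + 1) + α (k + 1)) (cov α k p) := rfl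
      have h2 : cov α (k + 2) (p + 1 + 1) =
          min (cov α (k + 1) (p + 1 + 1) + α (k + 1)) (cov α k (p + 1)) := rfl
      rw [h1, h2]; omega

theorem cov_convex (α : ℕ → ℕ) (k p : ℕ) :
    2 * cov α k (p + 1) ≤ cov α k p + cov α k (p + 2) := by
  have h1 := (cov_interlace α k).1 (p + 1)
  have h2 := (cov_interlace α k).2 p
  have h3 : p + 1 + 1 = p + 2 := rfl
  rw [h3] at h1 h2
  omega

theorem cov_subgrad (α : ℕ → ℕ) (k p : ℕ) : ∃ ρ : ℕ, ∀ q,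
    ρ * p + cov α k p ≤ ρ * q + cov α k q := by
  have hm := cov_mono α k
  have hc := cov_convex α k
  set c := cov α k with hcdef
  have hd : ∀ a e, c a + c (a + e + 1) ≥ c (a + e) + c (a + 1) := by
    intro a e
    induction e with
    | zero => simp
    | succ e ih =>
      have := hc (a + e)
      have e1 : a + (e + 1) = a + e + 1 := rfl
      have e2 : a + (e + 1) + 1 = a + e + 2 := rfl
      rw [e2, e1]; omega
  refine ⟨c p - c (p + 1), fun q => ?_⟩
  obtain ⟨ρ, hρ⟩ : ∃ ρ, c p = c (p + 1) + ρ := ⟨c p - c (p + 1), by have := hm p; omega⟩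
  have : c p - c (p + 1) = ρ := by omega
  rw [this]
  rcases le_total p q with h | h
  · obtain ⟨e, rfl⟩ := Nat.exists_eq_add_of_le h
    have : c p ≤ ρ * e + c (p + e) := by
      clear h
      induction e with
      | zero => simp
      | succ e ih =>
        have := hd p e
        have e1 : p + (e + 1) = p + e + 1 := rfl
        rw [e1, Nat.mul_succ]; omega
    rw [Nat.mul_add]; omega
  · obtain ⟨e, rfl⟩ := Nat.exists_eq_add_of_le h
    have : ∀ e', e' ≤ e → ρ * e' + c (q + e) ≤ c (q + (e - e')) := by
      intro e' he'
      induction e' with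
      | zero => simp
      | succ f ih =>
        have h1 := ih (by omega)
        have h2 := hd (q + (e - (f + 1))) f
        have h3 : q + (e - (f + 1)) + f + 1 = q + e := by omega
        have h4 := hd (q + (e - (f + 1))) (f + 1)
        have h5 : q + (e - (f + 1)) + (f + 1) + 1 = q + e + 1 := by omega
        have h6 : q + (e - (f + 1)) + (f + 1) = q + e := by omega
        have h7 : q + (e - (f + 1)) + 1 = q + (e - f) := by omega
        rw [h5, h6, h7] at h4
        rw [Nat.mul_succ]; omega
    have := this e le_rfl
    simp at this
    rw [Nat.mul_add]; omega

theorem cov_attained (α : ℕ → ℕ) (n : ℕ) (hn : 0 < n) : ∀ k ≤ n, ∀ p, ∃ κ : Fin p → ℕ,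
    (∀ l, κ l < n) ∧
    (∑ i ∈ Finset.range k, if (∃ l, κ l = i ∨ κ l = i + 1) then 0 else α i) ≤ cov α k p := by
  intro k
  induction k using Nat.strong_induction_on with
  | _ k ih =>
    intro hk p
    match k, p with
    | 0, _ => exact ⟨fun _ => 0, fun _ => hn, by simp⟩
    | 1, 0 => exact ⟨fun _ => 0, fun _ => hn, by simp [cov]⟩
    | 1, p + 1 => exact ⟨fun _ => 0, fun _ => hn, by simp [cov]⟩
    | k + 2, 0 =>
      obtain ⟨κ, h1, h2⟩ := ih (k + 1) (by omega) (by omega) 0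
      refine ⟨κ, h1, ?_⟩
      rw [Finset.sum_range_succ]
      simp only [cov]
      refine Nat.add_le_add h2 (by split_ifs <;> simp)
    | k + 2, p + 1 =>
      have h0 : cov α (k + 2) (p + 1) =
          min (cov α (k + 1) (p + 1) + α (k + 1)) (cov α k p) := rfl
      rcases le_total (cov α (k + 1) (p + 1) + α (k + 1)) (cov α k p) with hle | hle
      · rw [h0, min_eq_left hle]
        obtain ⟨κ, h1, h2⟩ := ih (k + 1) (by omega) (by omega) (p + 1)
        refine ⟨κ, h1, ?_⟩
        rw [Finset.sum_range_succ]
        refine Nat.add_le_add h2 (by split_ifs <;> simp)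
      · rw [h0, min_eq_right hle]
        obtain ⟨κ, h1, h2⟩ := ih k (by omega) (by omega) p
        refine ⟨Fin.cons (k + 1) κ, ?_, ?_⟩
        · intro l
          refine Fin.cases ?_ ?_ l
          · simp; omega
          · intro i; simpa using h1 i
        · rw [Finset.sum_range_succ, Finset.sum_range_succ, if_pos ⟨0, by simp⟩,
            if_pos ⟨0, by simp⟩, add_zero, add_zero]
          refine le_trans (Finset.sum_le_sum fun i _ => ?_) h2
          by_cases hi : ∃ l, κ l = i ∨ κ l = i + 1
          · obtain ⟨l, hl⟩ := hi
            rw [if_pos ⟨l.succ, by simpa using hl⟩]; simp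
          · rw [if_neg hi]; split_ifs <;> simp

/-- Greedy selection. -/
def greedy (α : ℕ → ℕ) (ρ : ℕ) : ℕ → ℕ
  | 0 => min (α 0) ρ
  | k + 1 => min (α (k + 1)) (ρ - greedy α ρ k)

theorem greedy_le (α : ℕ → ℕ) (ρ k : ℕ) : greedy α ρ k ≤ α k := by
  cases k <;> simp [greedy]

theorem greedy_le' (α : ℕ → ℕ) (ρ k : ℕ) : greedy α ρ k ≤ ρ := by
  cases k <;> simp [greedy]

theorem greedy_pair (α : ℕ → ℕ) (ρ k : ℕ) : greedy α ρ k + greedy α ρ (k + 1) ≤ ρ := by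
  have := greedy_le' α ρ k
  simp only [greedy]; omega

theorem greedy_sum (α : ℕ → ℕ) (ρ k : ℕ) :
    ∃ q, ρ * q + cov α k q ≤ ∑ i ∈ Finset.range k, greedy α ρ i := by
  induction k using Nat.strong_induction_on with
  | _ k ih =>
    match k with
    | 0 => exact ⟨0, by simp [cov]⟩
    | 1 =>
      rcases le_total (α 0) ρ with h | h
      · exact ⟨0, by simp [cov, greedy, h]⟩
      · exact ⟨1, by simp [cov, greedy, h]⟩
    | k + 2 =>
      rcases le_total (α (k + 1)) (ρ - greedy α ρ k) with h | h
      · obtain ⟨q, hq⟩ := ih (k + 1) (by omega)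
        refine ⟨q, ?_⟩
        rw [Finset.sum_range_succ]
        have : greedy α ρ (k + 1) = α (k + 1) := by simp [greedy, h]
        rw [this]
        have : cov α (k + 2) q ≤ cov α (k + 1) q + α (k + 1) := by
          cases q <;> simp [cov]
        omega
      · obtain ⟨q, hq⟩ := ih k (by omega)
        refine ⟨q + 1, ?_⟩
        rw [Finset.sum_range_succ, Finset.sum_range_succ]
        have h1 : greedy α ρ (k + 1) = ρ - greedy α ρ k := by simp [greedy, h]
        have := greedy_le' α ρ k
        have : cov α (k + 2) (q + 1) ≤ cov α k q := by simp [cov]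
        rw [Nat.mul_succ]
        omega

theorem pair_sum_le (β : ℕ → ℕ) (ρ : ℕ) (h : ∀ k, β k + β (k + 1) ≤ ρ) (n : ℕ) :
    ∑ i ∈ Finset.range n, β i ≤ ρ * ((n + 1) / 2) := by
  induction n using Nat.strong_induction_on with
  | _ n ih =>
    match n with
    | 0 => simp
    | 1 => have := h 0; simp; omega
    | k + 2 =>
      have h1 := ih k (by omega)
      rw [Finset.sum_range_succ, Finset.sum_range_succ]
      have : (k + 2 + 1) / 2 = (k + 1) / 2 + 1 := by omega
      rw [this, Nat.mul_succ]
      have := h k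
      omega

/-- Listing a multiset in increasing order. -/
theorem exists_listing (β : ℕ → ℕ) (n : ℕ) : ∃ b : ℕ → ℕ,
    (∀ q < ∑ i ∈ Finset.range n, β i, b q < n ∧ ∑ i ∈ Finset.range (b q), β i ≤ q ∧
      q < ∑ i ∈ Finset.range (b q + 1), β i) ∧
    ∀ (M : Type) [AddCommMonoid M] (g : ℕ → M),
      ∑ q ∈ Finset.range (∑ i ∈ Finset.range n, β i), g (b q) =
        ∑ k ∈ Finset.range n, β k • g k := by
  induction n with
  | zero => exact ⟨id, by simp⟩
  | succ n ih =>
    obtain ⟨b, h1, h2⟩ := ih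
    refine ⟨fun q => if q < ∑ i ∈ Finset.range n, β i then b q else n, ?_, ?_⟩
    · intro q hq
      by_cases h : q < ∑ i ∈ Finset.range n, β i
      · simp only [h, if_true]
        have := h1 q h
        exact ⟨by omega, this.2⟩
      · simp only [h, if_false]
        exact ⟨by omega, by omega, hq⟩
    · intro M _ g
      rw [Finset.sum_range_succ β, Finset.sum_range_succ, Finset.sum_range_add, ← h2]
      congr 1
      · refine Finset.sum_congr rfl fun q hq => ?_
        beta_reduce
        rw [if_pos (by simpa using hq)]
      · rw [Finset.sum_congr rfl (g := fun _ => g n)]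
        · simp
        · intro x _
          beta_reduce
          rw [if_neg (by omega)]

theorem listing_gap (β : ℕ → ℕ) (n ρ : ℕ) (h : ∀ k, β k + β (k + 1) ≤ ρ) (b : ℕ → ℕ)
    (hb : ∀ q < ∑ i ∈ Finset.range n, β i, b q < n ∧ ∑ i ∈ Finset.range (b q), β i ≤ q ∧
      q < ∑ i ∈ Finset.range (b q + 1), β i)
    (q : ℕ) (hq : q + ρ < ∑ i ∈ Finset.range n, β i) : b q + 2 ≤ b (q + ρ) := by
  have h1 := hb q (by omega)
  have h2 := hb (q + ρ) hq
  by_contra hlt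
  have h3 : ∑ i ∈ Finset.range (b (q + ρ) + 1), β i ≤ ∑ i ∈ Finset.range (b q + 2), β i :=
    Finset.sum_le_sum_of_subset (Finset.range_mono (by omega))
  rw [Finset.sum_range_succ, Finset.sum_range_succ β (b q + 1),
    Finset.sum_range_succ β (b q)] at h3
  have := h (b q)
  have h4 := h2.2.2
  rw [Finset.sum_range_succ] at h4
  omega

theorem sum_roundrobin {M : Type*} [AddCommMonoid M] (g : ℕ → M) (ρ d : ℕ) :
    ∑ l ∈ Finset.range ρ, ∑ i ∈ Finset.range d, g (l + i * ρ) =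
      ∑ q ∈ Finset.range (d * ρ), g q := by
  induction d with
  | zero => simp
  | succ d ih =>
    rw [Nat.succ_mul, Finset.sum_range_add, ← ih, ← Finset.sum_add_distrib]
    refine Finset.sum_congr rfl fun l _ => ?_
    rw [Finset.sum_range_succ, add_comm l]

theorem sum_roundrobin' {M : Type*} [AddCommMonoid M] (g : ℕ → M) (ρ d e : ℕ) (he : e ≤ ρ) :
    ∑ l ∈ Finset.range ρ, ∑ i ∈ Finset.range (if l < e then d + 1 else d), g (l + i * ρ) =
      ∑ q ∈ Finset.range (d * ρ + e), g q := by
  rw [Finset.sum_range_add, ← sum_roundrobin]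
  have : ∀ l, ∑ i ∈ Finset.range (if l < e then d + 1 else d), g (l + i * ρ) =
    ∑ i ∈ Finset.range d, g (l + i * ρ) + if l < e then g (d * ρ + l) else 0 := by
    intro l
    split_ifs
    · rw [Finset.sum_range_succ, add_comm l (d * ρ)]
    · simp
  simp_rw [this]
  rw [Finset.sum_add_distrib]
  congr 1
  rw [← Finset.sum_filter]
  refine Finset.sum_congr ?_ fun _ _ => rfl
  ext l; simp; omega

theorem gap_add (a : ℕ → ℕ) (d : ℕ) (h : ∀ i, i + 1 < d → a i + 2 ≤ a (i + 1)) :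
    ∀ i e, i + e < d → a i + 2 * e ≤ a (i + e) := by
  intro i e
  induction e with
  | zero => simp
  | succ e ih =>
    intro he
    have := ih (by omega)
    have := h (i + e) (by omega)
    have : i + (e + 1) = i + e + 1 := rfl
    rw [this]; omega

end HankelRes


namespace HankelRes

section Vanishing

variable (K : Type*) [Field K]

/-- Generic rank `p` Hankel point plus a generic perturbation. -/
noncomputable def Phi (n p : ℕ) : MvPolynomial (Fin n) K →ₐ[K]
    Polynomial (MvPolynomial ((Fin p ⊕ Fin p) ⊕ Fin n) K) :=
  MvPolynomial.aeval fun k =>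
    Polynomial.C (∑ l : Fin p, X (Sum.inl (Sum.inl l)) * X (Sum.inl (Sum.inr l)) ^ (n - 1 - k.1)) +
      Polynomial.X * Polynomial.C (X (Sum.inr k))

/-- Polynomials vanishing to order `s` along the Hankel matrices of rank at most `p`. -/
noncomputable def V (n p s : ℕ) : Ideal (MvPolynomial (Fin n) K) :=
  Ideal.comap (Phi K n p) (Ideal.span {Polynomial.X ^ s})

variable {K} {n : ℕ}

theorem mem_V {p s : ℕ} {f : MvPolynomial (Fin n) K} :
    f ∈ V K n p s ↔ Polynomial.X ^ s ∣ Phi K n p f := by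
  rw [V, Ideal.mem_comap, Ideal.mem_span_singleton]

theorem V_mul {p s s' : ℕ} {f g : MvPolynomial (Fin n) K} (hf : f ∈ V K n p s)
    (hg : g ∈ V K n p s') : f * g ∈ V K n p (s + s') := by
  rw [mem_V] at *
  rw [map_mul, pow_add]
  exact mul_dvd_mul hf hg

theorem V_anti {p s s' : ℕ} (h : s' ≤ s) : V K n p s ≤ V K n p s' := by
  intro f hf
  rw [mem_V] at *
  exact (pow_dvd_pow _ h).trans hf

theorem V_zero (p : ℕ) : V K n p 0 = ⊤ := by
  rw [eq_top_iff]; intro f _; rw [mem_V]; simp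

theorem V_prod {p : ℕ} {ι : Type*} (S : Finset ι) (s : ι → ℕ) (f : ι → MvPolynomial (Fin n) K)
    (h : ∀ i ∈ S, f i ∈ V K n p (s i)) : ∏ i ∈ S, f i ∈ V K n p (∑ i ∈ S, s i) := by
  classical
  induction S using Finset.induction_on with
  | empty => simp [V_zero]
  | insert a S ha ih =>
    rw [Finset.prod_insert ha, Finset.sum_insert ha]
    exact V_mul (h a (by simp)) (ih fun i hi => h i (by simp [hi]))

theorem V_ideal_pow {p s : ℕ} {J : Ideal (MvPolynomial (Fin n) K)} (h : J ≤ V K n p s) (r : ℕ) :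
    J ^ r ≤ V K n p (r * s) := by
  induction r with
  | zero => simp [V_zero]
  | succ r ih =>
    rw [pow_succ, Ideal.mul_le, Nat.succ_mul]
    exact fun a ha b hb => V_mul (ih ha) (h hb)

theorem V_ideal_mul {p s s' : ℕ} {J J' : Ideal (MvPolynomial (Fin n) K)} (h : J ≤ V K n p s)
    (h' : J' ≤ V K n p s') : J * J' ≤ V K n p (s + s') := by
  rw [Ideal.mul_le]
  exact fun a ha b hb => V_mul (h ha) (h' hb)

theorem V_one_prime (p : ℕ) : (V K n p 1).IsPrime := by
  have : (Ideal.span {(Polynomial.X : Polynomial (MvPolynomial ((Fin p ⊕ Fin p) ⊕ Fin n) K)) ^ 1}).IsPrime := by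
    rw [pow_one, Ideal.span_singleton_prime Polynomial.X_ne_zero]
    exact Polynomial.prime_X
  exact Ideal.comap_isPrime _ _

theorem V_cancel {p s : ℕ} {u f : MvPolynomial (Fin n) K} (hu : u ∉ V K n p 1)
    (h : u * f ∈ V K n p s) : f ∈ V K n p s := by
  rw [mem_V] at *
  rw [map_mul] at h
  rw [pow_one] at hu
  exact Polynomial.prime_X.pow_dvd_of_dvd_mul_left s hu h

variable (K n) in
/-- The `k`-th variable. -/
noncomputable def xx (k : ℕ) : MvPolynomial (Fin n) K := if h : k < n then X ⟨k, h⟩ else 0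

theorem det_rank_identity {S : Type*} [CommRing S] (d p : ℕ) (x : S) (U : Matrix (Fin d) (Fin p) S)
    (W : Matrix (Fin p) (Fin d) S) (B : Matrix (Fin d) (Fin d) S) :
    x ^ p * (U * W + x • B).det = (Matrix.fromBlocks (x • 1) (-W) U B).det * x ^ d := by
  have h1 : (Matrix.fromBlocks 1 (-W) U (x • B)).det = (U * W + x • B).det := by
    rw [Matrix.det_fromBlocks_one₁₁]
    congr 1
    rw [Matrix.mul_neg, sub_neg_eq_add, add_comm]
  have h2 : (Matrix.fromBlocks (x • (1 : Matrix (Fin p) (Fin p) S)) 0 0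
      (1 : Matrix (Fin d) (Fin d) S)).det = x ^ p := by
    rw [Matrix.det_fromBlocks_zero₁₂]; simp
  have h3 : (Matrix.fromBlocks (1 : Matrix (Fin p) (Fin p) S) 0 0
      (x • (1 : Matrix (Fin d) (Fin d) S))).det = x ^ d := by
    rw [Matrix.det_fromBlocks_zero₁₂]; simp
  rw [← h1, ← h2, ← h3, ← Matrix.det_mul, ← Matrix.det_mul, Matrix.fromBlocks_multiply,
    Matrix.fromBlocks_multiply]
  simp

theorem det_mem_V (p d R : ℕ) (r c : Fin d → ℕ) (hr : ∀ i, r i ≤ R) (hc : ∀ i, c i + R < n) :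
    (Matrix.of fun i j => xx K n (r i + c j)).det ∈ V K n p (d - p) := by
  rw [mem_V]
  set A := MvPolynomial ((Fin p ⊕ Fin p) ⊕ Fin n) K
  have hmap : Phi K n p (Matrix.of fun i j => xx K n (r i + c j)).det =
      ((Matrix.of fun (i : Fin d) (l : Fin p) => (Polynomial.C (X (Sum.inl (Sum.inl l)) *
          X (Sum.inl (Sum.inr l)) ^ (R - r i)) : Polynomial A)) *
        (Matrix.of fun (l : Fin p) (j : Fin d) => (Polynomial.C (
          X (Sum.inl (Sum.inr l)) ^ (n - 1 - R - c j)) : Polynomial A)) +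
        (Polynomial.X : Polynomial A) • (Matrix.of fun i j : Fin d =>
          (Polynomial.C (X (Sum.inr ⟨r i + c j, by have := hr i; have := hc j; omega⟩)) :
            Polynomial A))).det := by
    rw [AlgHom.map_det]
    congr 1
    ext1 i j
    have h : r i + c j < n := by have := hr i; have := hc j; omega
    simp only [AlgHom.mapMatrix_apply, Matrix.map_apply, Matrix.of_apply, xx, h, dif_pos,
      Matrix.add_apply, Matrix.smul_apply, Matrix.mul_apply, smul_eq_mul, Phi, aeval_X, map_sum]
    congr 1
    refine Finset.sum_congr rfl fun l _ => ?_
    rw [← Polynomial.C_mul, mul_assoc, ← pow_add]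
    congr 4
    have := hr i; have := hc j; omega
  rw [hmap]
  rcases le_total d p with h | h
  · rw [Nat.sub_eq_zero_of_le h]; simp
  · have key : ∀ (U : Matrix (Fin d) (Fin p) (Polynomial A)) (W : Matrix (Fin p) (Fin d) (Polynomial A))
        (B : Matrix (Fin d) (Fin d) (Polynomial A)),
        (Polynomial.X : Polynomial A) ^ (d - p) ∣ (U * W + (Polynomial.X : Polynomial A) • B).det := by
      intro U W B
      have e := det_rank_identity d p Polynomial.X U W B
      have h2 : (Polynomial.X : Polynomial A) ^ p * Polynomial.X ^ (d - p) ∣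
          Polynomial.X ^ p * (U * W + (Polynomial.X : Polynomial A) • B).det :=
        ⟨_, by rw [e, ← pow_add, Nat.add_sub_cancel' h, mul_comm]⟩
      exact (mul_dvd_mul_iff_left (pow_ne_zero p Polynomial.X_ne_zero)).1 h2
    exact key _ _ _

theorem xx_mem_V (k : ℕ) : xx K n k ∈ V K n 0 1 := by
  rw [mem_V, xx]
  split_ifs with h
  · simp [Phi]
  · simp

end Vanishing

end HankelRes


namespace HankelRes

section Core

variable {K : Type*} [Field K] {n : ℕ}

theorem V_spec {p s : ℕ} {f : MvPolynomial (Fin n) K} (hf : f ∈ V K n p s) (c D : Fin p → ℕ)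
    (w : Fin n → ℕ) :
    (Polynomial.C Polynomial.X : Polynomial (Polynomial K)) ^ s ∣
      aeval (fun k : Fin n => (∑ l, Polynomial.X ^ (c l + D l * (n - 1 - k.1)) +
        Polynomial.C Polynomial.X * Polynomial.X ^ (w k) : Polynomial (Polynomial K))) f := by
  rw [mem_V] at hf
  let g : MvPolynomial ((Fin p ⊕ Fin p) ⊕ Fin n) K →ₐ[K] Polynomial (Polynomial K) :=
    aeval (Sum.elim (Sum.elim (fun l => Polynomial.X ^ (c l)) (fun l => Polynomial.X ^ (D l)))
      (fun k => Polynomial.X ^ (w k)))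
  let G : Polynomial (MvPolynomial ((Fin p ⊕ Fin p) ⊕ Fin n) K) →+* Polynomial (Polynomial K) :=
    Polynomial.eval₂RingHom (g : _ →+* _) (Polynomial.C Polynomial.X)
  have hG : G.comp (Phi K n p : _ →+* _) = RingHomClass.toRingHom ((aeval (fun k : Fin n =>
      (∑ l, Polynomial.X ^ (c l + D l * (n - 1 - k.1)) +
        Polynomial.C Polynomial.X * Polynomial.X ^ (w k) : Polynomial (Polynomial K))) :
          MvPolynomial (Fin n) K →ₐ[K] Polynomial (Polynomial K))) := by
    apply MvPolynomial.ringHom_ext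
    · intro r
      simp [G, g, Phi, ← MvPolynomial.algebraMap_eq]
    · intro k
      simp [G, g, Phi, pow_add, pow_mul, Polynomial.eval₂_finsetSum, Polynomial.eval₂_pow]
  have h2 := map_dvd G hf
  have h3 := RingHom.congr_fun hG f
  simp only [RingHom.comp_apply, RingHom.coe_coe] at h3
  rw [← h3]
  simpa [G] using h2

theorem coeff_prod_le {ι S : Type*} [CommRing S] (s : Finset ι) (q : ι → Polynomial S) (w : ι → ℕ)
    (h : ∀ i ∈ s, (q i).natDegree ≤ w i) :
    (∏ i ∈ s, q i).natDegree ≤ ∑ i ∈ s, w i ∧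
    (∏ i ∈ s, q i).coeff (∑ i ∈ s, w i) = ∏ i ∈ s, (q i).coeff (w i) := by
  classical
  induction s using Finset.induction_on with
  | empty => simp
  | insert a s ha ih =>
    have ih := ih fun i hi => h i (by simp [hi])
    have h0 := h a (by simp)
    rw [Finset.prod_insert ha, Finset.sum_insert ha, Finset.prod_insert ha]
    refine ⟨Polynomial.natDegree_mul_le_of_le h0 ih.1, ?_⟩
    rw [Polynomial.coeff_mul_add_eq_of_natDegree_le h0 ih.1, ih.2]

theorem coeff_spec (f : MvPolynomial (Fin n) K) (α : Fin n →₀ ℕ)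
    (q : Fin n → Polynomial (Polynomial K)) (w : Fin n → ℕ) (hq : ∀ k, (q k).natDegree ≤ w k)
    (hw : ∀ β ∈ f.support, β ≠ α → ∑ k, β k * w k < ∑ k, α k * w k) :
    (aeval q f).coeff (∑ k, α k * w k) =
      Polynomial.C (f.coeff α) * ∏ k, (q k).coeff (w k) ^ (α k) := by
  have hb : ∀ β : Fin n →₀ ℕ, (∏ k, q k ^ β k).natDegree ≤ ∑ k, β k * w k ∧
      (∏ k, q k ^ β k).coeff (∑ k, β k * w k) = ∏ k, (q k ^ β k).coeff (β k * w k) := by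
    intro β
    exact coeff_prod_le _ _ _ fun k _ => Polynomial.natDegree_pow_le_of_le _ (hq k)
  rw [aeval_def, eval₂_eq', Polynomial.finsetSum_coeff, Finset.sum_eq_single α]
  · rw [IsScalarTower.algebraMap_apply K (Polynomial K) (Polynomial (Polynomial K))]
    change (Polynomial.C (Polynomial.C _) * _).coeff _ = _
    rw [Polynomial.coeff_C_mul, (hb α).2]
    congr 1
    refine Finset.prod_congr rfl fun k _ => ?_
    rw [Polynomial.coeff_pow_of_natDegree_le (hq k)]
  · intro β hβ hne
    rw [IsScalarTower.algebraMap_apply K (Polynomial K) (Polynomial (Polynomial K))]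
    change (Polynomial.C (Polynomial.C _) * _).coeff _ = _
    rw [Polynomial.coeff_C_mul, Polynomial.coeff_eq_zero_of_natDegree_lt, mul_zero]
    exact (hb β).1.trans_lt (hw β hβ hne)
  · intro h
    rw [notMem_support_iff.1 h]
    simp

theorem X_pow_dvd_aux [CharZero K] (s : ℕ) (a : K) (ha : a ≠ 0) (α N : Fin n → ℕ)
    (h : (Polynomial.X : Polynomial K) ^ s ∣
      Polynomial.C a * ∏ k, ((N k : Polynomial K) + Polynomial.X) ^ (α k)) :
    s ≤ ∑ k, if N k = 0 then α k else 0 := by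
  have e : ∏ k, ((N k : Polynomial K) + Polynomial.X) ^ (α k) =
      (Polynomial.X : Polynomial K) ^ (∑ k, if N k = 0 then α k else 0) *
        ∏ k, (if N k = 0 then 1 else ((N k : Polynomial K) + Polynomial.X) ^ (α k)) := by
    rw [← Finset.prod_pow_eq_pow_sum, ← Finset.prod_mul_distrib]
    refine Finset.prod_congr rfl fun k _ => ?_
    split_ifs with hk <;> simp [hk]
  rw [e, mul_left_comm] at h
  have hp : Prime (Polynomial.X : Polynomial K) := Polynomial.prime_X
  have := hp.pow_dvd_of_dvd_mul_right s ?_ h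
  · exact (pow_dvd_pow_iff Polynomial.X_ne_zero Polynomial.not_isUnit_X).1 this
  · intro hd
    rcases hp.dvd_or_dvd hd with hd | hd
    · rw [Polynomial.X_dvd_iff] at hd; simp [ha] at hd
    · obtain ⟨k, -, hk⟩ := (hp.dvd_finsetProd_iff _).1 hd
      split_ifs at hk with h0
      · exact hp.not_isUnit (isUnit_of_dvd_one hk)
      · have := hp.dvd_of_dvd_pow hk
        rw [Polynomial.X_dvd_iff] at this
        simp [h0] at this

theorem weight_lt (E b M : ℕ) (hb : b = E + 2) (hM : E * b ^ n < M) (α β : Fin n →₀ ℕ)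
    (hβ : β.degree ≤ E) (h : MonomialOrder.degLex.toSyn β < MonomialOrder.degLex.toSyn α) :
    ∑ k, β k * (M + b ^ (n - 1 - k.1)) < ∑ k, α k * (M + b ^ (n - 1 - k.1)) := by
  have h' := MonomialOrder.degLex_lt_iff.1 h
  rw [Finsupp.DegLex.lt_iff] at h'
  simp only [ofDegLex_toDegLex] at h'
  have hs : ∀ γ : Fin n →₀ ℕ, ∑ k, γ k * (M + b ^ (n - 1 - k.1)) =
      γ.degree * M + ∑ k, γ k * b ^ (n - 1 - k.1) := by
    intro γ
    rw [Finsupp.degree_eq_sum, Finset.sum_mul, ← Finset.sum_add_distrib]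
    exact Finset.sum_congr rfl fun k _ => by ring
  rw [hs, hs]
  rcases h' with h' | ⟨h1, h2⟩
  · have : ∑ k, β k * b ^ (n - 1 - k.1) ≤ E * b ^ n := by
      calc _ ≤ ∑ k, β k * b ^ n := Finset.sum_le_sum fun k _ =>
            Nat.mul_le_mul_left _ (Nat.pow_le_pow_right (by omega) (by omega))
        _ = β.degree * b ^ n := by rw [Finsupp.degree_eq_sum, Finset.sum_mul]
        _ ≤ _ := Nat.mul_le_mul_right _ hβ
    have h3 : (β.degree + 1) * M ≤ α.degree * M := Nat.mul_le_mul_right _ h'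
    rw [Nat.succ_mul] at h3
    omega
  · rw [h1]
    obtain ⟨i, hi1, hi2⟩ := Finsupp.Lex.lt_iff.1 h2
    simp only [toLex] at hi1 hi2
    change ∀ j < i, β j = α j at hi1
    change β i < α i at hi2
    have key : ∑ k, (b * (β k * b ^ (n - 1 - k.1)) + if k = i then b ^ (n - 1 - i.1 + 1) else 0) ≤
        ∑ k, (b * (α k * b ^ (n - 1 - k.1)) + β k * b ^ (n - 1 - i.1)) := by
      refine Finset.sum_le_sum fun k _ => ?_
      rcases lt_trichotomy k i with hk | hk | hk
      · rw [if_neg hk.ne, hi1 k hk]; omega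
      · subst hk
        rw [if_pos rfl, pow_succ]
        have := Nat.mul_le_mul_right (b * b ^ (n - 1 - k.1)) hi2
        nlinarith [Nat.zero_le (β k * b ^ (n - 1 - k.1))]
      · rw [if_neg hk.ne']
        have hk' : k.1 > i.1 := hk
        have : b ^ (n - 1 - k.1 + 1) ≤ b ^ (n - 1 - i.1) :=
          Nat.pow_le_pow_right (by omega) (by have := k.2; omega)
        have := Nat.mul_le_mul_left (β k) this
        rw [pow_succ] at this
        nlinarith [Nat.zero_le (b * (α k * b ^ (n - 1 - k.1)))]
    rw [Finset.sum_add_distrib, Finset.sum_add_distrib, ← Finset.mul_sum, ← Finset.mul_sum,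
      Finset.sum_ite_eq' Finset.univ i, if_pos (Finset.mem_univ _), ← Finset.sum_mul,
      ← Finsupp.degree_eq_sum] at key
    have h5 : β.degree * b ^ (n - 1 - i.1) < b ^ (n - 1 - i.1 + 1) := by
      rw [pow_succ, mul_comm]
      exact Nat.mul_lt_mul_of_pos_left (by omega) (Nat.pow_pos (by omega))
    have : b * ∑ k, β k * b ^ (n - 1 - k.1) < b * ∑ k, α k * b ^ (n - 1 - k.1) := by omega
    have := lt_of_mul_lt_mul_left' this
    omega

theorem bern (c u : ℕ) (hc : 1 ≤ c) : 1 + c * (u + 1) ≤ (c + 1) ^ (u + 1) ∧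
    (1 + c * (u + 1) = (c + 1) ^ (u + 1) → u = 0) := by
  induction u with
  | zero => simp; omega
  | succ u ih =>
    have h := ih.1
    have : 1 + c * (u + 1 + 1) < (c + 1) ^ (u + 1 + 1) := by
      rw [pow_succ]
      have := Nat.mul_le_mul_right (c + 1) h
      have : 1 ≤ c * (c * (u + 1)) := Nat.mul_pos hc (Nat.mul_pos hc (by omega))
      nlinarith
    exact ⟨this.le, fun h => absurd h this.ne⟩

theorem tangent (b M k κ : ℕ) (hb : 2 ≤ b) (hM : κ * b ^ (κ + 1) ≤ M) :
    (M + b ^ κ - κ * (b ^ (κ + 1) - b ^ κ)) + (b ^ (κ + 1) - b ^ κ) * k ≤ M + b ^ k ∧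
    ((M + b ^ κ - κ * (b ^ (κ + 1) - b ^ κ)) + (b ^ (κ + 1) - b ^ κ) * k = M + b ^ k ↔
      k = κ ∨ k = κ + 1) := by
  obtain ⟨c, rfl⟩ : ∃ c, b = c + 1 := ⟨b - 1, by omega⟩
  have hc : 1 ≤ c := by omega
  have hD : (c + 1) ^ (κ + 1) - (c + 1) ^ κ = c * (c + 1) ^ κ := by
    rw [pow_succ]; apply Nat.sub_eq_of_eq_add; ring
  have hM' : κ * (c * (c + 1) ^ κ) ≤ M := by
    refine le_trans (Nat.mul_le_mul_left _ ?_) hM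
    rw [pow_succ]; nlinarith [Nat.zero_le ((c + 1) ^ κ)]
  rw [hD]
  have hpos : 0 < (c + 1) ^ κ := by positivity
  rcases lt_or_ge κ k with h | h
  · obtain ⟨u, rfl⟩ : ∃ u, k = κ + (u + 1) := ⟨k - κ - 1, by omega⟩
    have e : (M + (c + 1) ^ κ - κ * (c * (c + 1) ^ κ)) + c * (c + 1) ^ κ * (κ + (u + 1)) =
        M + (c + 1) ^ κ * (1 + c * (u + 1)) := by
      zify [show κ * (c * (c + 1) ^ κ) ≤ M + (c + 1) ^ κ by omega]; ring
    rw [e, pow_add]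
    obtain ⟨h1, h2⟩ := bern c u hc
    refine ⟨by have := Nat.mul_le_mul_left ((c + 1) ^ κ) h1; omega, ?_⟩
    constructor
    · intro h3
      have := h2 (Nat.eq_of_mul_eq_mul_left hpos (by omega))
      omega
    · intro h3
      have : u = 0 := by omega
      subst this
      simp [add_comm]
  · obtain ⟨u, rfl⟩ : ∃ u, κ = k + u := ⟨κ - k, by omega⟩
    have e : (M + (c + 1) ^ (k + u) - (k + u) * (c * (c + 1) ^ (k + u))) +
        c * (c + 1) ^ (k + u) * k + u * (c * (c + 1) ^ (k + u)) = M + (c + 1) ^ (k + u) := by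
      zify [show (k + u) * (c * (c + 1) ^ (k + u)) ≤ M + (c + 1) ^ (k + u) by omega]; ring
    rcases Nat.eq_zero_or_pos u with rfl | hu
    · simp at e ⊢; omega
    · have h1 : (c + 1) ^ (k + u) ≤ u * (c * (c + 1) ^ (k + u)) := by
        rw [← mul_assoc]; exact Nat.le_mul_of_pos_left _ (Nat.mul_pos hu hc)
      have h2 : 0 < (c + 1) ^ k := by positivity
      constructor
      · omega
      · omega

/-- Extension of an exponent vector by zero. -/
def ex (α : Fin n →₀ ℕ) (k : ℕ) : ℕ := if h : k < n then α ⟨k, h⟩ else 0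

theorem core [CharZero K] {p s : ℕ} {f : MvPolynomial (Fin n) K} (hf : f ∈ V K n p s) (h0 : f ≠ 0)
    (κ : Fin p → ℕ) (hκ : ∀ l, κ l < n) :
    s ≤ ∑ k ∈ Finset.range n, if (∃ l, κ l = k ∨ κ l = k + 1) then 0
      else ex (MonomialOrder.degLex.degree f) k := by
  classical
  set α := MonomialOrder.degLex.degree f with hα
  set E := f.totalDegree
  obtain ⟨b, hb⟩ : ∃ b, b = E + 2 := ⟨_, rfl⟩
  obtain ⟨M, hM⟩ : ∃ M, M = (n + E + 1) * b ^ (n + 1) := ⟨_, rfl⟩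
  have hbp : 0 < b ^ n := Nat.pow_pos (by omega)
  have hM1 : E * b ^ n < M := by
    rw [hM, pow_succ]
    have : 2 * b ^ n ≤ b * b ^ n := Nat.mul_le_mul_right _ (by omega)
    nlinarith [Nat.zero_le (n * (b ^ n * b)), Nat.zero_le (E * (b ^ n * b)), Nat.zero_le (E * b ^ n)]
  have hM2 : ∀ l, (n - 1 - κ l) * b ^ (n - 1 - κ l + 1) ≤ M := by
    intro l
    rw [hM]
    exact Nat.mul_le_mul (by omega) (Nat.pow_le_pow_right (by omega) (by omega))
  have tg := fun (k : Fin n) l => tangent b M (n - 1 - k.1) (n - 1 - κ l) (by omega) (hM2 l)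
  let w : Fin n → ℕ := fun k => M + b ^ (n - 1 - k.1)
  let D : Fin p → ℕ := fun l => b ^ (n - 1 - κ l + 1) - b ^ (n - 1 - κ l)
  let c : Fin p → ℕ := fun l => M + b ^ (n - 1 - κ l) - (n - 1 - κ l) * D l
  have hd := V_spec hf c D w
  have hco := coeff_spec f α (fun k : Fin n =>
    (∑ l, Polynomial.X ^ (c l + D l * (n - 1 - k.1)) +
        Polynomial.C Polynomial.X * Polynomial.X ^ (w k) : Polynomial (Polynomial K))) w ?_ ?_
  · rw [← map_pow, Polynomial.C_dvd_iff_dvd_coeff] at hd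
    have hd := hd (∑ k, α k * w k)
    rw [hco] at hd
    have hN : ∀ k : Fin n, (∑ l, Polynomial.X ^ (c l + D l * (n - 1 - k.1)) +
        Polynomial.C Polynomial.X * Polynomial.X ^ (w k) : Polynomial (Polynomial K)).coeff (w k) =
        (((Finset.univ.filter fun l => w k = c l + D l * (n - 1 - k.1)).card : ℕ) : Polynomial K)
          + Polynomial.X := by
      intro k
      rw [Polynomial.coeff_add, Polynomial.finsetSum_coeff, Polynomial.coeff_C_mul]
      simp only [Polynomial.coeff_X_pow, if_pos, mul_one, Finset.sum_boole]
    simp only [hN] at hd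
    have hfin := X_pow_dvd_aux s _ ?_ _ _ hd
    · refine hfin.trans ?_
      rw [← Fin.sum_univ_eq_sum_range (fun k => if (∃ l, κ l = k ∨ κ l = k + 1) then 0 else ex α k) n]
      refine Finset.sum_le_sum fun k _ => ?_
      have hex : ex α k = α k := by simp [ex]
      rw [hex]
      split_ifs with h1 h2
      · exfalso
        obtain ⟨l, hl⟩ := h2
        rw [Finset.card_eq_zero, Finset.filter_eq_empty_iff] at h1
        refine h1 (Finset.mem_univ l) ((tg k l).2.2 ?_).symm
        have := k.2; have := hκ l; omega
      · exact le_rfl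
      · exact Nat.zero_le _
      · exact Nat.zero_le _
    · rw [hα]; exact MonomialOrder.leadingCoeff_ne_zero_iff.2 h0
  · intro k
    refine Polynomial.natDegree_add_le_of_degree_le (Polynomial.natDegree_sum_le_of_forall_le _ _ ?_)
      ?_
    · intro l _
      rw [Polynomial.natDegree_X_pow]
      exact (tg k l).1
    · exact Polynomial.natDegree_C_mul_X_pow_le _ _
  · intro β hβ hne
    refine weight_lt E b M hb hM1 α β ?_ ?_
    · rw [Finsupp.degree_eq_sum]
      have := MvPolynomial.le_totalDegree hβ
      rwa [Finsupp.sum_fintype _ _ (fun _ => rfl)] at this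
    · refine lt_of_le_of_ne (MonomialOrder.le_degree hβ) ?_
      intro h; exact hne (MonomialOrder.degLex.toSyn.injective h)

end Core

end HankelRes


namespace HankelRes

section Minors

variable {K : Type*} [Field K] {n : ℕ}

theorem reduce (W J : Ideal (MvPolynomial (Fin n) K)) (hJ : J ≤ W)
    (h : ∀ f ∈ W, f ≠ 0 → ∃ g ∈ J, g ≠ 0 ∧
      MonomialOrder.degLex.degree g = MonomialOrder.degLex.degree f) : W ≤ J := by
  have key : ∀ (x : MonomialOrder.degLex.syn) (f : MvPolynomial (Fin n) K),
      MonomialOrder.degLex.toSyn (MonomialOrder.degLex.degree f) = x → f ∈ W → f ∈ J := by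
    intro x
    induction x using WellFoundedLT.induction with
    | ind x ih =>
      intro f hx hf
      by_cases h0 : f = 0
      · subst h0; exact J.zero_mem
      obtain ⟨g, hg, hg0, hgd⟩ := h f hf h0
      set c := MonomialOrder.degLex.leadingCoeff f / MonomialOrder.degLex.leadingCoeff g
      have hcg : C c * g ∈ J := J.mul_mem_left _ hg
      by_cases h1 : f - C c * g = 0
      · rw [sub_eq_zero.1 h1]; exact hcg
      have h2 : f - C c * g ∈ J := by
        refine ih _ ?_ _ rfl (W.sub_mem hf (hJ hcg))
        rw [← hx]
        refine lt_of_le_of_ne ?_ ?_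
        · refine le_trans MonomialOrder.degree_sub_le (sup_le le_rfl ?_)
          refine le_trans MonomialOrder.degree_mul_le ?_
          rw [MonomialOrder.degree_C, zero_add, hgd]
        · intro e
          have e := MonomialOrder.degLex.toSyn.injective e
          have h3 := MonomialOrder.leadingCoeff_ne_zero_iff (m := MonomialOrder.degLex).2 h1
          apply h3
          rw [MonomialOrder.leadingCoeff, e, coeff_sub, coeff_C_mul]
          change MonomialOrder.degLex.leadingCoeff f - c * _ = 0
          rw [← hgd]
          change MonomialOrder.degLex.leadingCoeff f - c * MonomialOrder.degLex.leadingCoeff g = 0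
          rw [div_mul_cancel₀ _ (MonomialOrder.leadingCoeff_ne_zero_iff.2 hg0), sub_self]
      have := J.add_mem h2 hcg
      simpa using this
  exact fun f hf => key _ f rfl hf

variable (n) in
/-- Unit exponent vector. -/
noncomputable def sg (k : ℕ) : Fin n →₀ ℕ := if h : k < n then Finsupp.single ⟨k, h⟩ 1 else 0

theorem sg_apply {k : ℕ} (h : k < n) (i : Fin n) : sg n k i = if k = i.1 then 1 else 0 := by
  simp [sg, h, Finsupp.single_apply, Fin.ext_iff]

theorem sg_degree {k : ℕ} (h : k < n) : (sg n k).degree = 1 := by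
  simp [sg, h]

theorem xx_eq {k : ℕ} (h : k < n) : xx K n k = monomial (sg n k) 1 := by
  simp [xx, sg, h, X]

theorem eq_sum_sg (α : Fin n →₀ ℕ) : α = ∑ k ∈ Finset.range n, ex α k • sg n k := by
  ext i
  rw [Finsupp.finsetSum_apply, Finset.sum_eq_single i.1]
  · simp [sg_apply i.2, ex]
  · intro k hk hne
    simp [sg_apply (Finset.mem_range.1 hk), hne]
  · simp

theorem degree_eq_ex (α : Fin n →₀ ℕ) : α.degree = ∑ k ∈ Finset.range n, ex α k := by
  rw [Finsupp.degree_eq_sum, ← Fin.sum_univ_eq_sum_range]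
  simp [ex]

theorem perm_lt (d : ℕ) (r c : Fin d → ℕ) (hr : StrictMono r) (hc : StrictMono c)
    (h : ∀ i j, r i + c j < n) (σ : Equiv.Perm (Fin d)) (hσ : σ ≠ 1) :
    MonomialOrder.degLex.toSyn (∑ i, sg n (r (σ i) + c i)) <
      MonomialOrder.degLex.toSyn (∑ i, sg n (r i + c i)) := by
  rw [MonomialOrder.degLex_lt_iff, Finsupp.DegLex.lt_iff]
  right
  simp only [ofDegLex_toDegLex]
  constructor
  · simp only [map_sum]
    exact Finset.sum_congr rfl fun i _ => by rw [sg_degree (h _ _), sg_degree (h _ _)]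
  have hne : (Finset.univ.filter fun i => σ i ≠ i).Nonempty := by
    by_contra hcon
    rw [Finset.not_nonempty_iff_eq_empty, Finset.filter_eq_empty_iff] at hcon
    exact hσ (Equiv.ext fun i => by simpa using hcon (Finset.mem_univ i))
  obtain ⟨i0, hi0, hmin⟩ := Finset.exists_min_image _ id hne
  simp only [Finset.mem_filter, Finset.mem_univ, true_and, id] at hi0 hmin
  have hfix : ∀ i < i0, σ i = i := by
    intro i hi
    by_contra hcon
    exact absurd (hmin i hcon) (not_le.2 hi)
  have hge : ∀ i, i0 ≤ i → i0 ≤ σ i := by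
    intro i hi
    by_contra hcon
    have h1 := hfix (σ i) (not_le.1 hcon)
    have h2 := σ.injective h1
    rw [h2] at hcon
    exact hcon hi
  have hgt : ∀ i, i0 ≤ i → r i0 + c i0 < r (σ i) + c i := by
    intro i hi
    have h1 := hr.monotone (hge i hi)
    have h2 := hc.monotone hi
    rcases hi.eq_or_lt with e | e
    · subst e
      have := hr (lt_of_le_of_ne (hge i0 le_rfl) (Ne.symm hi0))
      omega
    · have := hc e
      omega
  have hge' : ∀ i, i0 ≤ i → r i0 + c i0 ≤ r i + c i := fun i hi =>
    Nat.add_le_add (hr.monotone hi) (hc.monotone hi)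
  rw [Finsupp.Lex.lt_iff]
  refine ⟨⟨r i0 + c i0, h _ _⟩, ?_, ?_⟩
  · intro k hk
    have hk' : k.1 < r i0 + c i0 := hk
    change (∑ i, sg n (r (σ i) + c i)) k = (∑ i, sg n (r i + c i)) k
    rw [Finsupp.finsetSum_apply, Finsupp.finsetSum_apply]
    refine Finset.sum_congr rfl fun i _ => ?_
    rw [sg_apply (h _ _), sg_apply (h _ _)]
    rcases lt_or_ge i i0 with hi | hi
    · rw [hfix i hi]
    · have := hgt i hi
      have := hge' i hi
      rw [if_neg (by omega), if_neg (by omega)]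
  · change (∑ i, sg n (r (σ i) + c i)) _ < (∑ i, sg n (r i + c i)) _
    rw [Finsupp.finsetSum_apply, Finsupp.finsetSum_apply]
    refine Finset.sum_lt_sum (fun i _ => ?_) ⟨i0, Finset.mem_univ _, ?_⟩
    · rw [sg_apply (h _ _), sg_apply (h _ _)]
      rcases lt_or_ge i i0 with hi | hi
      · rw [hfix i hi]
      · have := hgt i hi
        rw [if_neg (by simp only; omega)]
        exact Nat.zero_le _
    · rw [sg_apply (h _ _), sg_apply (h _ _)]
      have := hgt i0 le_rfl
      rw [if_neg (by simp only; omega), if_pos rfl]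
      exact Nat.one_pos

theorem det_degree (d : ℕ) (r c : Fin d → ℕ) (hr : StrictMono r) (hc : StrictMono c)
    (h : ∀ i j, r i + c j < n) :
    (Matrix.of fun i j => xx K n (r i + c j)).det ≠ 0 ∧
    MonomialOrder.degLex.degree (Matrix.of fun i j => xx K n (r i + c j)).det =
      ∑ i, sg n (r i + c i) := by
  classical
  have hdet : (Matrix.of fun i j => xx K n (r i + c j)).det =
      ∑ σ : Equiv.Perm (Fin d), monomial (∑ i, sg n (r (σ i) + c i))
        (((Equiv.Perm.sign σ : ℤˣ) : ℤ) : K) := by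
    rw [Matrix.det_apply']
    refine Finset.sum_congr rfl fun σ _ => ?_
    have : ∏ i, (Matrix.of fun i j => xx K n (r i + c j)) (σ i) i =
        monomial (∑ i, sg n (r (σ i) + c i)) 1 := by
      rw [monomial_sum_one]
      exact Finset.prod_congr rfl fun i _ => xx_eq (h _ _)
    rw [this, ← map_intCast (C : K →+* _), C_mul_monomial, mul_one]
  have hco : ∀ m, coeff m (Matrix.of fun i j => xx K n (r i + c j)).det =
      ∑ σ : Equiv.Perm (Fin d), if (∑ i, sg n (r (σ i) + c i)) = m then
        (((Equiv.Perm.sign σ : ℤˣ) : ℤ) : K) else 0 := by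
    intro m
    rw [hdet, coeff_sum]
    exact Finset.sum_congr rfl fun σ _ => coeff_monomial _ _ _
  have hone : coeff (∑ i, sg n (r i + c i)) (Matrix.of fun i j => xx K n (r i + c j)).det = 1 := by
    rw [hco, Finset.sum_eq_single 1]
    · simp
    · intro σ _ hσ
      rw [if_neg]
      intro e
      exact absurd (congrArg MonomialOrder.degLex.toSyn e) (perm_lt d r c hr hc h σ hσ).ne
    · simp
  have h0 : (Matrix.of fun i j => xx K n (r i + c j)).det ≠ 0 := by
    intro h0
    rw [h0, coeff_zero] at hone
    exact zero_ne_one hone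
  refine ⟨h0, ?_⟩
  apply MonomialOrder.degLex.toSyn.injective
  apply le_antisymm
  · have h1 := MonomialOrder.leadingCoeff_ne_zero_iff (m := MonomialOrder.degLex).2 h0
    rw [MonomialOrder.leadingCoeff, hco] at h1
    obtain ⟨σ, -, hσ⟩ := Finset.exists_ne_zero_of_sum_ne_zero h1
    have h2 : ∑ i, sg n (r (σ i) + c i) = MonomialOrder.degLex.degree
      (Matrix.of fun i j => xx K n (r i + c j)).det := by
      by_contra hcon; rw [if_neg hcon] at hσ; exact hσ rfl
    rw [← h2]
    by_cases e : σ = 1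
    · subst e; exact le_rfl
    · exact (perm_lt d r c hr hc h σ e).le
  · apply MonomialOrder.le_degree
    rw [mem_support_iff, hone]
    exact one_ne_zero

theorem chain_minor (d : ℕ) (a : ℕ → ℕ) (ha : ∀ i, i + 1 < d → a i + 2 ≤ a (i + 1))
    (han : ∀ i < d, a i < n) : ∃ δ : MvPolynomial (Fin n) K, δ ≠ 0 ∧
      MonomialOrder.degLex.degree δ = ∑ i ∈ Finset.range d, sg n (a i) ∧
      ∀ p, δ ∈ V K n p (d - p) := by
  have hg : ∀ i j, i ≤ j → j < d → a i + 2 * (j - i) ≤ a j := fun i j hij hj => by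
    have := gap_add a d ha i (j - i) (by omega)
    rwa [Nat.add_sub_cancel' hij] at this
  have h0 : ∀ i < d, 2 * i ≤ a i := fun i hi => by
    have := hg 0 i; omega
  have h1 : ∀ i < d, a i + 2 * (d - 1 - i) < n := fun i hi => by
    have := hg i (d - 1); have := han (d - 1) (by omega); omega
  obtain ⟨e1, e2⟩ := det_degree (K := K) (n := n) d (fun i => i.1) (fun i => a i.1 - i.1)
    (fun i j hij => hij) (fun i j hij => by
      have := hg i.1 j.1; have := h0 i.1 i.2; have := h0 j.1 j.2
      have : i.1 < j.1 := hij
      simp only; omega)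
    (fun i j => by have := h1 j.1 j.2; have := h0 j.1 j.2; have := i.2; omega)
  refine ⟨_, e1, ?_, fun p => det_mem_V p d (d - 1) _ _ (fun i => ?_) (fun i => ?_)⟩
  · rw [e2, ← Fin.sum_univ_eq_sum_range]
    refine Finset.sum_congr rfl fun i _ => ?_
    have := h0 i.1 i.2
    congr 1; omega
  · have := i.2; omega
  · have := h1 i.1 i.2; have := h0 i.1 i.2; have := i.2; omega

variable (K n) in
/-- The ideal of `t`-minors. -/
noncomputable def Im (j t : ℕ) : Ideal (MvPolynomial (Fin n) K) := Ideal.span {d |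
      ∃ (ri : Fin t → Fin j) (ci : Fin t → Fin (n + 1 - j)),
        Function.Injective ri ∧ Function.Injective ci ∧
        d = Matrix.det (Matrix.of fun a b => xx K n ((ri a).1 + (ci b).1))}

theorem Im_le (j t : ℕ) (hj : j ≤ n) (p : ℕ) : Im K n j t ≤ V K n p (t - p) := by
  rw [Im, Ideal.span_le]
  rintro d ⟨ri, ci, -, -, rfl⟩
  refine det_mem_V p t (j - 1) (fun i => (ri i).1) (fun i => (ci i).1) (fun i => ?_) (fun i => ?_)
  · have := (ri i).2; omega
  · have := (ri i).2; have := (ci i).2; omega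

theorem chain_minor_t (j t : ℕ) (hj : j ≤ n) (htj : t ≤ j) (htn : t ≤ n + 1 - j)
    (a : ℕ → ℕ) (ha : ∀ i, i + 1 < t → a i + 2 ≤ a (i + 1))
    (han : ∀ i < t, a i < n) : ∃ δ : MvPolynomial (Fin n) K, δ ≠ 0 ∧
      MonomialOrder.degLex.degree δ = ∑ i ∈ Finset.range t, sg n (a i) ∧ δ ∈ Im K n j t := by
  have hg : ∀ i j, i ≤ j → j < t → a i + 2 * (j - i) ≤ a j := fun i j hij hj => by
    have := gap_add a t ha i (j - i) (by omega)
    rwa [Nat.add_sub_cancel' hij] at this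
  have h0 : ∀ i < t, 2 * i ≤ a i := fun i hi => by
    have := hg 0 i; omega
  have h1 : ∀ i < t, a i + 2 * (t - 1 - i) < n := fun i hi => by
    have := hg i (t - 1); have := han (t - 1) (by omega); omega
  let c : ℕ → ℕ := fun i => min (a i - i) (n - j - (t - 1 - i))
  let r : ℕ → ℕ := fun i => a i - c i
  have hc : ∀ i j, i < j → j < t → c i < c j := by
    intro i j hij hj
    have := hg i j; have := h0 i (by omega); have := h0 j hj
    simp only [c]; omega
  have hr : ∀ i j, i < j → j < t → r i < r j := by
    intro i j hij hj
    have := hg i j; have := h0 i (by omega); have := h0 j hj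
    simp only [r, c]; omega
  have hrj : ∀ i < t, r i < j := by
    intro i hi
    have := h0 i hi; have := h1 i hi
    simp only [r, c]; omega
  have hcj : ∀ i < t, c i < n + 1 - j := by
    intro i hi
    simp only [c]; omega
  obtain ⟨e1, e2⟩ := det_degree (K := K) (n := n) t (fun i => r i.1) (fun i => c i.1)
    (fun i j hij => hr _ _ hij j.2) (fun i j hij => hc _ _ hij j.2)
    (fun i j => by have := hrj i.1 i.2; have := hcj j.1 j.2; omega)
  refine ⟨_, e1, ?_, Ideal.subset_span ⟨fun i => ⟨r i.1, hrj i.1 i.2⟩,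
    fun i => ⟨c i.1, hcj i.1 i.2⟩, ?_, ?_, rfl⟩⟩
  · rw [e2, ← Fin.sum_univ_eq_sum_range]
    refine Finset.sum_congr rfl fun i _ => ?_
    have := h0 i.1 i.2
    congr 1; simp only [r, c]; omega
  · exact StrictMono.injective (fun i j hij => hr _ _ hij j.2)
  · exact StrictMono.injective (fun i j hij => hc _ _ hij j.2)

end Minors

end HankelRes


namespace HankelRes

section Main

variable {K : Type*} [Field K] {n : ℕ}

theorem cov_ge [CharZero K] (hn : 0 < n) {p s : ℕ} {f : MvPolynomial (Fin n) K}
    (hf : f ∈ V K n p s) (h0 : f ≠ 0) :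
    s ≤ cov (ex (MonomialOrder.degLex.degree f)) n p := by
  obtain ⟨κ, h1, h2⟩ := cov_attained (ex (MonomialOrder.degLex.degree f)) n hn n le_rfl p
  exact (core hf h0 κ h1).trans h2

theorem degree_ge [CharZero K] {s : ℕ} {f : MvPolynomial (Fin n) K}
    (hf : f ∈ V K n 0 s) (h0 : f ≠ 0) : s ≤ (MonomialOrder.degLex.degree f).degree := by
  have := core hf h0 Fin.elim0 (fun l => l.elim0)
  rw [degree_eq_ex]
  simpa using this

theorem listing (α : Fin n →₀ ℕ) (ρ : ℕ) : ∃ (b : ℕ → ℕ) (γ : Fin n →₀ ℕ) (L : ℕ),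
    L = ∑ i ∈ Finset.range n, greedy (ex α) ρ i ∧ (∀ q < L, b q < n) ∧
    (∀ q, q + ρ < L → b q + 2 ≤ b (q + ρ)) ∧
    α = ∑ q ∈ Finset.range L, sg n (b q) + γ := by
  obtain ⟨b, hb1, hb2⟩ := exists_listing (greedy (ex α) ρ) n
  refine ⟨b, ∑ k ∈ Finset.range n, (ex α k - greedy (ex α) ρ k) • sg n k, _, rfl,
    fun q hq => (hb1 q hq).1,
    fun q hq => listing_gap (greedy (ex α) ρ) n ρ (fun k => greedy_pair _ _ k) b hb1 q hq, ?_⟩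
  rw [hb2 _ (sg n), ← Finset.sum_add_distrib]
  conv_lhs => rw [eq_sum_sg α]
  refine Finset.sum_congr rfl fun k _ => ?_
  rw [← add_smul, Nat.add_sub_cancel' (greedy_le _ _ _)]

theorem degree_mono_one (γ : Fin n →₀ ℕ) :
    MonomialOrder.degLex.degree (monomial γ (1 : K)) = γ := by
  classical
  rw [MonomialOrder.degree_monomial, if_neg one_ne_zero]

theorem lemmaA (α : Fin n →₀ ℕ) (ρ L : ℕ) (hL : L = ∑ i ∈ Finset.range n, greedy (ex α) ρ i) :
    ∃ g : MvPolynomial (Fin n) K, g ≠ 0 ∧ MonomialOrder.degLex.degree g = α ∧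
      ∀ p, g ∈ V K n p (L - ρ * p) := by
  obtain ⟨b, γ, L', hL', hb1, hb2, hα⟩ := listing α ρ
  obtain rfl : L' = L := by rw [hL, hL']
  set len : ℕ → ℕ := fun l => if l < L' % ρ then L' / ρ + 1 else L' / ρ with hlen
  have hmod : L' / ρ * ρ + L' % ρ = L' := by rw [mul_comm]; exact Nat.div_add_mod _ _
  have hle : L' % ρ ≤ ρ := by
    rcases Nat.eq_zero_or_pos ρ with h | h
    · have : L' = 0 := by
        rw [hL']
        refine Finset.sum_eq_zero fun i _ => ?_
        have := greedy_le' (ex α) ρ i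
        omega
      simp [this]
    · exact (Nat.mod_lt _ h).le
  have hrange : ∀ l < ρ, ∀ i < len l, l + i * ρ < L' := by
    intro l hl i hi
    simp only [hlen] at hi
    split_ifs at hi with h
    · have : i * ρ ≤ L' / ρ * ρ := Nat.mul_le_mul_right _ (by omega)
      omega
    · have : (i + 1) * ρ ≤ L' / ρ * ρ := Nat.mul_le_mul_right _ (by omega)
      rw [Nat.succ_mul] at this
      omega
  have hch : ∀ l < ρ, ∃ δ : MvPolynomial (Fin n) K, δ ≠ 0 ∧
      MonomialOrder.degLex.degree δ = ∑ i ∈ Finset.range (len l), sg n (b (l + i * ρ)) ∧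
      ∀ p, δ ∈ V K n p (len l - p) := by
    intro l hl
    refine chain_minor (len l) (fun i => b (l + i * ρ)) (fun i hi => ?_)
      (fun i hi => hb1 _ (hrange l hl i hi))
    have h1 := hrange l hl (i + 1) hi
    have e : l + (i + 1) * ρ = l + i * ρ + ρ := by ring
    simp only [e] at h1 ⊢
    exact hb2 _ h1
  choose! δ h1 h2 h3 using hch
  have hP : ∏ l ∈ Finset.range ρ, δ l ≠ 0 :=
    Finset.prod_ne_zero_iff.2 fun l hl => h1 l (Finset.mem_range.1 hl)
  have hm : monomial γ (1 : K) ≠ 0 := by simp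
  refine ⟨(∏ l ∈ Finset.range ρ, δ l) * monomial γ 1, mul_ne_zero hP hm, ?_, fun p => ?_⟩
  · rw [MonomialOrder.degree_mul hP hm, degree_mono_one,
      MonomialOrder.degree_prod fun l hl => h1 l (Finset.mem_range.1 hl),
      Finset.sum_congr rfl fun l hl => h2 l (Finset.mem_range.1 hl)]
    have := sum_roundrobin' (fun q => sg n (b q)) ρ (L' / ρ) (L' % ρ) hle
    rw [hmod] at this
    rw [this]
    exact hα.symm
  · refine Ideal.mul_mem_right _ _ ?_
    refine V_anti ?_ (V_prod (Finset.range ρ) (fun l => len l - p) δ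
      fun l hl => h3 l (Finset.mem_range.1 hl) p)
    have := sum_roundrobin' (fun _ => (1 : ℕ)) ρ (L' / ρ) (L' % ρ) hle
    rw [hmod] at this
    simp only [Finset.sum_const, Finset.card_range, smul_eq_mul, mul_one] at this
    have h4 : ∑ l ∈ Finset.range ρ, len l ≤ ∑ l ∈ Finset.range ρ, (len l - p + p) :=
      Finset.sum_le_sum fun l _ => by omega
    rw [Finset.sum_add_distrib] at h4
    simp only [Finset.sum_const, Finset.card_range, smul_eq_mul] at h4
    have h5 : ∑ l ∈ Finset.range ρ, len l = L' := this
    omega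

theorem monomial_mem (γ : Fin n →₀ ℕ) :
    monomial γ (1 : K) ∈ (Ideal.span (Set.range (X : Fin n → MvPolynomial (Fin n) K))) ^ γ.degree := by
  rw [monomial_eq, C_1, one_mul, Finsupp.prod_fintype _ _ (fun _ => pow_zero _),
    Finsupp.degree_eq_sum, ← Finset.prod_pow_eq_pow_sum]
  exact Ideal.prod_mem_prod fun k _ => Ideal.pow_mem_pow (Ideal.subset_span (Set.mem_range_self k)) _

theorem lemmaB (j t r : ℕ) (hj : j ≤ n) (htj : t ≤ j) (htn : t ≤ n + 1 - j) (α : Fin n →₀ ℕ)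
    (h : ∀ q < t, r * (t - q) ≤ cov (ex α) n q) :
    ∃ g : MvPolynomial (Fin n) K, g ≠ 0 ∧ MonomialOrder.degLex.degree g = α ∧
      g ∈ (Ideal.span (Set.range (X : Fin n → MvPolynomial (Fin n) K))) ^ (α.degree - t * r) *
        Im K n j t ^ r := by
  obtain ⟨b, γ, L, hL, hb1, hb2, hα⟩ := listing α r
  have hLt : t * r ≤ L := by
    obtain ⟨q, hq⟩ := greedy_sum (ex α) r n
    rw [← hL] at hq
    rcases lt_or_ge q t with h1 | h1
    · have h2 := h q h1
      have h3 : t * r = r * q + r * (t - q) := by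
        rw [← mul_add, Nat.add_sub_cancel' h1.le, mul_comm]
      omega
    · have : t * r ≤ r * q := by rw [mul_comm]; exact Nat.mul_le_mul_left _ h1
      omega
  have hrange : ∀ l < r, ∀ i < t, l + i * r < L := by
    intro l hl i hi
    have : (i + 1) * r ≤ t * r := Nat.mul_le_mul_right _ (by omega)
    rw [Nat.succ_mul] at this
    omega
  have hch : ∀ l < r, ∃ δ : MvPolynomial (Fin n) K, δ ≠ 0 ∧
      MonomialOrder.degLex.degree δ = ∑ i ∈ Finset.range t, sg n (b (l + i * r)) ∧
      δ ∈ Im K n j t := by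
    intro l hl
    refine chain_minor_t j t hj htj htn (fun i => b (l + i * r)) (fun i hi => ?_)
      (fun i hi => hb1 _ (hrange l hl i hi))
    have h1 := hrange l hl (i + 1) hi
    have e : l + (i + 1) * r = l + i * r + r := by ring
    simp only [e] at h1 ⊢
    exact hb2 _ h1
  choose! δ h1 h2 h3 using hch
  have hP : ∏ l ∈ Finset.range r, δ l ≠ 0 :=
    Finset.prod_ne_zero_iff.2 fun l hl => h1 l (Finset.mem_range.1 hl)
  obtain ⟨e, he⟩ : ∃ e, L = t * r + e := ⟨L - t * r, by omega⟩
  set γ' := ∑ x ∈ Finset.range e, sg n (b (t * r + x)) + γ with hγ'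
  have hα' : α = ∑ q ∈ Finset.range (t * r), sg n (b q) + γ' := by
    rw [hγ', hα, he, Finset.sum_range_add, add_assoc]
  have hm : monomial γ' (1 : K) ≠ 0 := by simp
  refine ⟨monomial γ' 1 * ∏ l ∈ Finset.range r, δ l, mul_ne_zero hm hP, ?_, ?_⟩
  · rw [MonomialOrder.degree_mul hm hP, degree_mono_one,
      MonomialOrder.degree_prod fun l hl => h1 l (Finset.mem_range.1 hl),
      Finset.sum_congr rfl fun l hl => h2 l (Finset.mem_range.1 hl),
      sum_roundrobin (fun q => sg n (b q)) r t, add_comm]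
    exact hα'.symm
  · refine Ideal.mul_mem_mul ?_ ?_
    · have : α.degree - t * r = γ'.degree := by
        rw [hα', map_add, map_sum, Finset.sum_congr rfl fun q hq =>
          sg_degree (hb1 q (by have := Finset.mem_range.1 hq; omega))]
        simp
      rw [this]
      exact monomial_mem _
    · have := Ideal.prod_mem_prod (s := Finset.range r) (I := fun _ => Im K n j t) (x := δ)
        fun l hl => h3 l (Finset.mem_range.1 hl)
      simpa using this

theorem Im_eq [CharZero K] (j t : ℕ) (hj : j ≤ n) (ht1 : 1 ≤ t) (htj : t ≤ j)
    (htn : t ≤ n + 1 - j) : Im K n j t = V K n (t - 1) 1 := by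
  have hle : Im K n j t ≤ V K n (t - 1) 1 := by
    have := Im_le (K := K) j t hj (t - 1)
    rwa [show t - (t - 1) = 1 by omega] at this
  refine le_antisymm hle (reduce _ _ hle fun f hf h0 => ?_)
  set α := MonomialOrder.degLex.degree f
  have hc : _ ≤ cov (ex α) n _ := cov_ge (by omega) hf h0
  obtain ⟨ρ, hρ⟩ := cov_subgrad (ex α) n (t - 1)
  have hρ0 : 1 ≤ ρ := by
    by_contra hcon
    have : ρ = 0 := by omega
    subst this
    obtain ⟨q, hq⟩ := greedy_sum (ex α) 0 n
    have h1 := hρ q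
    have h2 : ∑ i ∈ Finset.range n, greedy (ex α) 0 i = 0 :=
      Finset.sum_eq_zero fun i _ => by have := greedy_le' (ex α) 0 i; omega
    omega
  obtain ⟨g, g0, gd, hg⟩ := lemmaB (K := K) j t 1 hj htj htn α (fun q hq => by
    have h1 := hρ q
    obtain ⟨u, hu⟩ : ∃ u, t - 1 = q + u := ⟨t - 1 - q, by omega⟩
    rw [hu, mul_add] at h1
    rw [hu] at hc
    have : u ≤ ρ * u := Nat.le_mul_of_pos_left _ hρ0
    omega)
  refine ⟨g, ?_, g0, gd⟩
  have := Ideal.mul_le_right hg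
  rwa [pow_one] at this

theorem V_le_pow [CharZero K] (j t N s r : ℕ) (hj : j ≤ n) (ht1 : 1 ≤ t) (htj : t ≤ j)
    (htn : t ≤ n + 1 - j)
    (hs : r * ((N + t) * ((n + 1) / 2 - t + 1)) ≤ (n + 1) / 2 * s) :
    V K n (t - 1) s ≤
      ((Ideal.span (Set.range (X : Fin n → MvPolynomial (Fin n) K))) ^ N * Im K n j t) ^ r := by
  set 𝔪 := Ideal.span (Set.range (X : Fin n → MvPolynomial (Fin n) K)) with h𝔪
  obtain ⟨m, hm⟩ : ∃ m, m = (n + 1) / 2 := ⟨_, rfl⟩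
  rw [← hm] at hs
  have htm : t ≤ m := by omega
  obtain ⟨u, hu⟩ : ∃ u, m = t - 1 + u := ⟨m - (t - 1), by omega⟩
  rw [show m - t + 1 = u by omega] at hs
  have hu1 : 1 ≤ u := by omega
  set B : Ideal (MvPolynomial (Fin n) K) :=
    (⨅ p : Fin t, V K n p.1 (r * (t - p.1))) ⊓ V K n 0 ((N + t) * r) with hB
  have h1 : V K n (t - 1) s ≤ V K n (t - 1) s ⊓ B := by
    refine reduce _ _ inf_le_left fun f hf h0 => ?_
    set α := MonomialOrder.degLex.degree f
    have hc : _ ≤ cov (ex α) n _ := cov_ge (by omega) hf h0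
    obtain ⟨ρ, hρ⟩ := cov_subgrad (ex α) n (t - 1)
    obtain ⟨q, hq⟩ := greedy_sum (ex α) ρ n
    have hLm := pair_sum_le (greedy (ex α) ρ) ρ (fun k => greedy_pair _ _ _) n
    rw [← hm] at hLm
    obtain ⟨L, hL⟩ : ∃ L, L = ∑ i ∈ Finset.range n, greedy (ex α) ρ i := ⟨_, rfl⟩
    rw [← hL] at hq hLm
    have hL1 : ρ * (t - 1) + s ≤ L := by have := hρ q; omega
    have hsu : s ≤ ρ * u := by rw [hu, mul_add] at hLm; omega
    have hkey : ∀ p < t, s * (m - p) ≤ u * (L - ρ * p) := by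
      intro p hp
      obtain ⟨v, hv⟩ : ∃ v, t - 1 = p + v := ⟨t - 1 - p, by omega⟩
      have e1 : m - p = v + u := by omega
      have e2 : ρ * v + s ≤ L - ρ * p := by
        rw [hv, mul_add] at hL1; omega
      rw [e1]
      have := Nat.mul_le_mul_left u e2
      have h5 := Nat.mul_le_mul_right v hsu
      nlinarith
    obtain ⟨g, g0, gd, hg⟩ := lemmaA (K := K) α ρ L hL
    refine ⟨g, ⟨?_, ?_, ?_⟩, g0, gd⟩
    · exact V_anti (by omega) (hg (t - 1))
    · refine (Ideal.mem_iInf).2 fun p => V_anti ?_ (hg p.1)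
      have hp := p.2
      have h5 := hkey p.1 hp
      have h6 : t * (m - p.1) ≥ m * (t - p.1) := by
        zify [show p.1 ≤ m by omega, hp.le]
        have : (t : ℤ) ≤ m := by exact_mod_cast htm
        nlinarith [(Nat.cast_nonneg p.1 : (0 : ℤ) ≤ (p.1 : ℤ))]
      have h7 : m * u * (r * (t - p.1)) ≤ m * u * (L - ρ * p.1) := by
        calc m * u * (r * (t - p.1)) = r * u * (m * (t - p.1)) := by ring
          _ ≤ r * u * (t * (m - p.1)) := Nat.mul_le_mul_left _ h6
          _ ≤ r * u * ((N + t) * (m - p.1)) :=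
            Nat.mul_le_mul_left _ (Nat.mul_le_mul_right _ (by omega))
          _ = r * ((N + t) * u) * (m - p.1) := by ring
          _ ≤ m * s * (m - p.1) := Nat.mul_le_mul_right _ hs
          _ = m * (s * (m - p.1)) := by ring
          _ ≤ m * (u * (L - ρ * p.1)) := Nat.mul_le_mul_left _ h5
          _ = _ := by ring
      exact Nat.le_of_mul_le_mul_left h7 (Nat.mul_pos (by omega) hu1)
    · refine V_anti ?_ (hg 0)
      have h5 := hkey 0 (by omega)
      have h7 : u * ((N + t) * r) ≤ u * (L - ρ * 0) := by
        refine le_trans ?_ h5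
        rw [Nat.sub_zero]
        calc _ = r * ((N + t) * u) := by ring
          _ ≤ m * s := hs
          _ = _ := mul_comm _ _
      exact Nat.le_of_mul_le_mul_left h7 hu1
  have h𝔪1 : 𝔪 ≤ V K n 0 1 := by
    rw [h𝔪, Ideal.span_le]
    rintro _ ⟨k, rfl⟩
    have := xx_mem_V (K := K) (n := n) k.1
    rwa [xx, dif_pos k.2] at this
  have h2 : (𝔪 ^ N * Im K n j t) ^ r ≤ B := by
    refine le_inf (le_iInf fun p => ?_) ?_
    · exact (Ideal.pow_right_mono Ideal.mul_le_right r).trans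
        (V_ideal_pow (Im_le j t hj p.1) r)
    · have h3 := V_ideal_mul (V_ideal_pow h𝔪1 N) (Im_le (K := K) j t hj 0)
      have h4 := V_ideal_pow h3 r
      rwa [mul_one, Nat.sub_zero, mul_comm r] at h4
  refine (h1.trans inf_le_right).trans (reduce _ _ h2 fun f hf h0 => ?_)
  set α := MonomialOrder.degLex.degree f
  obtain ⟨g, g0, gd, hg⟩ := lemmaB (K := K) j t r hj htj htn α (fun q hq =>
    cov_ge (by omega) ((Ideal.mem_iInf).1 hf.1 ⟨q, hq⟩) h0)
  refine ⟨g, ?_, g0, gd⟩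
  have h5 := degree_ge hf.2 h0
  rw [mul_pow, ← pow_mul]
  refine Ideal.mul_mono_left (Ideal.pow_le_pow_right ?_) hg
  rw [add_mul] at h5
  change _ ≤ α.degree at h5
  omega

end Main

end HankelRes


namespace HankelRes

section Final

theorem symbolic_mem {R : Type*} [CommRing R] [IsNoetherianRing R] (I : Ideal R) (hI : I.IsPrime)
    (s : ℕ) (f : R) : f ∈ symbolicPower I s ↔ ∃ u, u ∉ I ∧ u * f ∈ I ^ s := by
  have hass : associatedPrimes R (R ⧸ I) = {I} := by
    have := associatedPrimes.eq_singleton_of_isPrimary hI.isPrimary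
    rwa [hI.radical] at this
  have hmem : I ∈ associatedPrimes R (R ⧸ I) := by rw [hass]; rfl
  have key : ∀ (p : Ideal R) (hp : p.IsPrime),
      f ∈ Ideal.comap (algebraMap R (Localization.AtPrime p))
        (Ideal.map (algebraMap R (Localization.AtPrime p)) (I ^ s)) ↔
      ∃ u, u ∉ p ∧ u * f ∈ I ^ s := by
    intro p hp
    rw [Ideal.mem_comap, IsLocalization.algebraMap_mem_map_algebraMap_iff p.primeCompl]
    simp [Ideal.mem_primeCompl_iff]
  rw [symbolicPower, Ideal.mem_iInf]
  constructor
  · intro h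
    exact (key I hI).1 (h ⟨I, hmem⟩)
  · rintro h ⟨p, hp⟩
    have hpI : p = I := by rw [hass] at hp; exact hp
    subst hpI
    exact (key p hI).2 h

theorem det_mem_pow {R : Type*} [CommRing R] (I : Ideal R) (u : ℕ) (A : Matrix (Fin u) (Fin u) R)
    (h : ∀ i j, A i j ∈ I) : A.det ∈ I ^ u := by
  rw [Matrix.det_apply']
  refine Ideal.sum_mem _ fun σ _ => Ideal.mul_mem_left _ _ ?_
  have := Ideal.prod_mem_prod (s := Finset.univ) (I := fun _ : Fin u => I)
    (x := fun i => A (σ i) i) fun i _ => h _ _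
  simpa using this

theorem schur {R : Type*} [CommRing R] (p u : ℕ) (A : Matrix (Fin p) (Fin p) R)
    (B : Matrix (Fin p) (Fin u) R) (C : Matrix (Fin u) (Fin p) R) (E : Matrix (Fin u) (Fin u) R) :
    A.det ^ u * (Matrix.fromBlocks A B C E).det =
      A.det * (A.det • E - C * A.adjugate * B).det := by
  have h1 : (Matrix.fromBlocks (1 : Matrix (Fin p) (Fin p) R) 0 (-(C * A.adjugate))
      (A.det • (1 : Matrix (Fin u) (Fin u) R))).det = A.det ^ u := by
    rw [Matrix.det_fromBlocks_zero₁₂]; simp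
  rw [← h1, ← Matrix.det_mul, Matrix.fromBlocks_multiply]
  have h2 : -(C * A.adjugate) * A + A.det • (1 : Matrix (Fin u) (Fin u) R) * C = 0 := by
    rw [Matrix.neg_mul, Matrix.mul_assoc, Matrix.adjugate_mul]; simp
  rw [h2]
  simp only [Matrix.one_mul, Matrix.zero_mul, add_zero]
  rw [Matrix.det_fromBlocks_zero₂₁]
  congr 2
  simp [Matrix.neg_mul, sub_eq_add_neg, add_comm]

variable {K : Type*} [Field K] {n : ℕ}

theorem blocks_det (p u : ℕ) (r c : Fin u → ℕ) :
    (Matrix.fromBlocks (Matrix.of fun i j : Fin p => xx K n (i.1 + j.1))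
      (Matrix.of fun (i : Fin p) (j : Fin u) => xx K n (i.1 + c j))
      (Matrix.of fun (i : Fin u) (j : Fin p) => xx K n (r i + j.1))
      (Matrix.of fun i j : Fin u => xx K n (r i + c j))).det =
    (Matrix.of fun i j : Fin (p + u) => xx K n
      ((Sum.elim (fun i : Fin p => i.1) r (finSumFinEquiv.symm i)) +
        (Sum.elim (fun i : Fin p => i.1) c (finSumFinEquiv.symm j)))).det := by
  rw [← Matrix.det_submatrix_equiv_self (finSumFinEquiv (m := p) (n := u))]
  congr 1
  ext i j
  rcases i with i | i <;> rcases j with j | j <;> simp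

theorem sum_sg_degree (d : ℕ) (a : Fin d → ℕ) (h : ∀ i, a i < n) :
    (∑ i, sg n (a i)).degree = d := by
  rw [map_sum, Finset.sum_congr rfl fun i _ => sg_degree (h i)]
  simp

theorem lower_key [CharZero K] (j t : ℕ) (hj : j ≤ n) (ht1 : 1 ≤ t) (htj : t ≤ j)
    (htn : t ≤ n + 1 - j) : ∃ f D : MvPolynomial (Fin n) K, f ≠ 0 ∧
      (MonomialOrder.degLex.degree f).degree = (n + 1) / 2 ∧ D ∉ Im K n j t ∧
      D ^ ((n + 1) / 2 - t + 1) * f ∈ Im K n j t ^ ((n + 1) / 2 - t + 1) := by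
  obtain ⟨m, hm⟩ : ∃ m, m = (n + 1) / 2 := ⟨_, rfl⟩
  rw [← hm]
  obtain ⟨p, rfl⟩ : ∃ p, t = p + 1 := ⟨t - 1, by omega⟩
  obtain ⟨u, hu⟩ : ∃ u, m = p + u := ⟨m - p, by omega⟩
  rw [show m - (p + 1) + 1 = u by omega]
  have hu1 : 1 ≤ u := by omega
  obtain ⟨d1, d2⟩ := det_degree (K := K) (n := n) p (fun i => i.1) (fun i => i.1)
    (fun i j hij => hij) (fun i j hij => hij) (fun i j => by have := i.2; have := j.2; omega)
  obtain ⟨f1, f2⟩ := det_degree (K := K) (n := n) (p + u) (fun i => i.1) (fun i => i.1)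
    (fun i j hij => hij) (fun i j hij => hij) (fun i j => by have := i.2; have := j.2; omega)
  refine ⟨_, (Matrix.of fun i j : Fin p => xx K n (i.1 + j.1)).det, f1, ?_, ?_, ?_⟩
  · rw [f2, sum_sg_degree, hu]
    intro i; have := i.2; omega
  · intro hD
    have h1 := Im_le j (p + 1) hj 0 hD
    have h2 := degree_ge h1 d1
    rw [d2, sum_sg_degree] at h2
    · omega
    · intro i; have := i.2; omega
  · have hfb := blocks_det (K := K) (n := n) p u (fun i => p + i.1) (fun i => p + i.1)
    have e : ∀ i : Fin (p + u), Sum.elim (fun i : Fin p => i.1) (fun i : Fin u => p + i.1)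
        (finSumFinEquiv.symm i) = i.1 := by
      intro i
      obtain ⟨x, rfl⟩ := finSumFinEquiv.surjective i
      rcases x with x | x <;> simp
    simp only [e] at hfb
    rw [← hfb, schur]
    refine Ideal.mul_mem_left _ _ (det_mem_pow _ _ _ fun a b => ?_)
    have hs := schur p 1 (Matrix.of fun i j : Fin p => xx K n (i.1 + j.1))
      (Matrix.of fun (i : Fin p) (j : Fin 1) => xx K n (i.1 + (p + b.1)))
      (Matrix.of fun (i : Fin 1) (j : Fin p) => xx K n ((p + a.1) + j.1))
      (Matrix.of fun i j : Fin 1 => xx K n ((p + a.1) + (p + b.1)))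
    rw [pow_one] at hs
    have hs := mul_left_cancel₀ d1 hs
    have hb1 := blocks_det (K := K) (n := n) p 1 (fun i => p + a.1) (fun i => p + b.1)
    rw [Im_eq j (p + 1) hj ht1 htj htn]
    have hmem := det_mem_V (K := K) (n := n) p (p + 1) (m - 1)
      (fun i => Sum.elim (fun i : Fin p => i.1) (fun _ : Fin 1 => p + a.1) (finSumFinEquiv.symm i))
      (fun i => Sum.elim (fun i : Fin p => i.1) (fun _ : Fin 1 => p + b.1) (finSumFinEquiv.symm i))
      (fun i => by
        obtain ⟨x, rfl⟩ := finSumFinEquiv.surjective i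
        have := a.2
        rcases x with x | x <;> simp <;> omega)
      (fun i => by
        obtain ⟨x, rfl⟩ := finSumFinEquiv.surjective i
        have := b.2
        rcases x with x | x <;> simp <;> omega)
    rw [← hb1, hs, Matrix.det_fin_one] at hmem
    rw [show p + 1 - p = 1 by omega] at hmem
    exact hmem

theorem upper [CharZero K] (j t N s r : ℕ) (hj : j ≤ n) (ht1 : 1 ≤ t) (htj : t ≤ j)
    (htn : t ≤ n + 1 - j)
    (hs : r * ((N + t) * ((n + 1) / 2 - t + 1)) ≤ (n + 1) / 2 * s) :
    symbolicPower (Im K n j t) s ≤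
      ((Ideal.span (Set.range (X : Fin n → MvPolynomial (Fin n) K))) ^ N * Im K n j t) ^ r := by
  refine le_trans ?_ (V_le_pow j t N s r hj ht1 htj htn hs)
  have hI := Im_eq (K := K) j t hj ht1 htj htn
  have hp : (Im K n j t).IsPrime := by rw [hI]; exact V_one_prime _
  intro f hf
  obtain ⟨u, hu, huf⟩ := (symbolic_mem _ hp s f).1 hf
  rw [hI] at hu huf
  have h1 := V_ideal_pow (le_refl (V K n (t - 1) 1)) s huf
  rw [mul_one] at h1
  exact V_cancel hu h1

theorem lower [CharZero K] (j t N s r a : ℕ) (hj : j ≤ n) (ht1 : 1 ≤ t) (htj : t ≤ j)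
    (htn : t ≤ n + 1 - j)
    (hle : symbolicPower (Im K n j t) s ≤
      ((Ideal.span (Set.range (X : Fin n → MvPolynomial (Fin n) K))) ^ N * Im K n j t) ^ r)
    (hs : s ≤ ((n + 1) / 2 - t + 1) * a) : r * (N + t) ≤ a * ((n + 1) / 2) := by
  have hI := Im_eq (K := K) j t hj ht1 htj htn
  have hp : (Im K n j t).IsPrime := by rw [hI]; exact V_one_prime _
  obtain ⟨f, D, f0, fd, hD, hDf⟩ := lower_key (K := K) j t hj ht1 htj htn
  set u := (n + 1) / 2 - t + 1
  have hmem : f ^ a ∈ symbolicPower (Im K n j t) s := by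
    refine (symbolic_mem _ hp s _).2 ⟨(D ^ u) ^ a, ?_, ?_⟩
    · intro h
      exact hD (hp.mem_of_pow_mem _ (hp.mem_of_pow_mem _ h))
    · rw [← mul_pow]
      have := Ideal.pow_mem_pow hDf a
      rw [← pow_mul] at this
      exact Ideal.pow_le_pow_right hs this
  have h𝔪1 : Ideal.span (Set.range (X : Fin n → MvPolynomial (Fin n) K)) ≤ V K n 0 1 := by
    rw [Ideal.span_le]
    rintro _ ⟨k, rfl⟩
    have := xx_mem_V (K := K) (n := n) k.1
    rwa [xx, dif_pos k.2] at this
  have h3 := V_ideal_mul (V_ideal_pow h𝔪1 N) (Im_le (K := K) j t hj 0)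
  have h4 := degree_ge (V_ideal_pow h3 r (hle hmem)) (pow_ne_zero a f0)
  rw [mul_one, Nat.sub_zero, MonomialOrder.degree_pow, map_nsmul, fd, smul_eq_mul] at h4
  exact h4

theorem final_sup (P : ℕ → ℕ → Prop) (m u A : ℕ) (hm : 0 < m) (hu : 0 < u) (hA : 0 < A)
    (h1 : ∀ s r, r * (A * u) ≤ m * s → P s r)
    (h2 : ∀ s r a, P s r → s ≤ u * a → r * A ≤ a * m) :
    sSup {x : ℝ | ∃ s r : ℕ, 0 < s ∧ 0 < r ∧ x = (s : ℝ) / r ∧ ¬ P s r} =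
      ((A * u : ℕ) : ℝ) / (m : ℝ) ∧
    sSup {x : ℝ | ∃ s r : ℕ, 0 < s ∧ 0 < r ∧ x = (s : ℝ) / r ∧
      ∀ᶠ T in atTop, ¬ P (s * T) (r * T)} = ((A * u : ℕ) : ℝ) / (m : ℝ) := by
  have hmR : (0 : ℝ) < m := by exact_mod_cast hm
  have hC : (0 : ℝ) < ((A * u : ℕ) : ℝ) / (m : ℝ) :=
    div_pos (by exact_mod_cast Nat.mul_pos hA hu) hmR
  have hsub : {x : ℝ | ∃ s r : ℕ, 0 < s ∧ 0 < r ∧ x = (s : ℝ) / r ∧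
      ∀ᶠ T in atTop, ¬ P (s * T) (r * T)} ⊆
      {x : ℝ | ∃ s r : ℕ, 0 < s ∧ 0 < r ∧ x = (s : ℝ) / r ∧ ¬ P s r} := by
    rintro x ⟨s, r, hs, hr, rfl, hT⟩
    obtain ⟨T, hT1, hT2⟩ := (hT.and (eventually_ge_atTop 1)).exists
    refine ⟨s * T, r * T, Nat.mul_pos hs hT2, Nat.mul_pos hr hT2, ?_, hT1⟩
    have : (T : ℝ) ≠ 0 := by positivity
    push_cast
    rw [mul_div_mul_right _ _ this]
  have hub : ∀ x ∈ {x : ℝ | ∃ s r : ℕ, 0 < s ∧ 0 < r ∧ x = (s : ℝ) / r ∧ ¬ P s r},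
      x ≤ ((A * u : ℕ) : ℝ) / (m : ℝ) := by
    rintro x ⟨s, r, hs, hr, rfl, hP⟩
    have h : m * s < r * (A * u) := by
      by_contra hcon
      exact hP (h1 s r (not_lt.1 hcon))
    have hrR : (0 : ℝ) < r := by exact_mod_cast hr
    rw [div_le_div_iff₀ hrR hmR]
    have : ((m * s : ℕ) : ℝ) ≤ ((r * (A * u) : ℕ) : ℝ) := by exact_mod_cast h.le
    push_cast at this ⊢
    linarith
  have hlb : ∀ y < ((A * u : ℕ) : ℝ) / (m : ℝ), ∃ x ∈ {x : ℝ | ∃ s r : ℕ, 0 < s ∧ 0 < r ∧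
      x = (s : ℝ) / r ∧ ∀ᶠ T in atTop, ¬ P (s * T) (r * T)}, y < x := by
    intro y hy
    obtain ⟨q, hq1, hq2⟩ := exists_rat_btwn (max_lt hy hC)
    have hq0 : 0 < q := by
      have := (le_max_right y 0).trans_lt hq1
      exact_mod_cast this
    have hnum : 0 < q.num := Rat.num_pos.2 hq0
    have hden : 0 < q.den := q.den_pos
    obtain ⟨s, hs⟩ : ∃ s : ℕ, q.num = s := ⟨q.num.toNat, by omega⟩
    have hqe : (q : ℝ) = (s : ℝ) / (q.den : ℝ) := by
      rw [Rat.cast_def, hs]; simp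
    refine ⟨(q : ℝ), ⟨s, q.den, by omega, hden, hqe, ?_⟩, (le_max_left y 0).trans_lt hq1⟩
    have hlt : m * s + 1 ≤ q.den * (A * u) := by
      rw [hqe, div_lt_div_iff₀ (by exact_mod_cast hden) hmR] at hq2
      have : s * m < A * u * q.den := by exact_mod_cast hq2
      nlinarith
    filter_upwards [eventually_gt_atTop (u * m)] with T hT hP
    have h3 := h2 _ _ (s * T / u + 1) hP (by
      have := Nat.lt_mul_div_succ (s * T) hu
      exact this.le)
    have h4 : u * (s * T / u) ≤ s * T := Nat.mul_div_le _ _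
    have h5 := Nat.mul_le_mul_left u h3
    have h6 := Nat.mul_le_mul_right T hlt
    have h7 := Nat.mul_le_mul_right m h4
    nlinarith
  have hne : {x : ℝ | ∃ s r : ℕ, 0 < s ∧ 0 < r ∧ x = (s : ℝ) / r ∧
      ∀ᶠ T in atTop, ¬ P (s * T) (r * T)}.Nonempty := by
    obtain ⟨x, hx, -⟩ := hlb 0 hC
    exact ⟨x, hx⟩
  constructor
  · refine csSup_eq_of_forall_le_of_forall_lt_exists_gt (hne.mono hsub) hub fun y hy => ?_
    obtain ⟨x, hx, h⟩ := hlb y hy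
    exact ⟨x, hsub hx, h⟩
  · exact csSup_eq_of_forall_le_of_forall_lt_exists_gt hne (fun x hx => hub x (hsub hx)) hlb

end Final

end HankelRes


/-- Theorem 4.6(3): let `X_j` be the `j × (n+1-j)` Hankel matrix in the variables
`x_1, …, x_n`, `I_t(X_j)` the ideal of its `t × t` minors, `𝔪 = (x_1, …, x_n)`, and
`m = ⌊(n+1)/2⌋`. Then for every non-negative integer `N`, the resurgence and the asymptotic
resurgence of the pair of families `(I_t(X_j)^{(•)}, (𝔪^N I_t(X_j))^•)` both equal
`(N+t)(m-t+1)/m`. -/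
theorem hankel_pair_resurgence {K : Type*} [Field K] [CharZero K]
    (n j t : ℕ) (hj : j ≤ n) (ht1 : 1 ≤ t) (ht : t ≤ min j (n + 1 - j)) (N : ℕ) :
    let m : ℕ := (n + 1) / 2
    let 𝔪 : Ideal (MvPolynomial (Fin n) K) := Ideal.span (Set.range MvPolynomial.X)
    let I : Ideal (MvPolynomial (Fin n) K) := Ideal.span {d |
      ∃ (ri : Fin t → Fin j) (ci : Fin t → Fin (n + 1 - j)),
        Function.Injective ri ∧ Function.Injective ci ∧
        d = Matrix.det (Matrix.of fun a b =>
          (MvPolynomial.X ⟨(ri a).1 + (ci b).1,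
            by have := (ri a).2; have := (ci b).2; omega⟩ : MvPolynomial (Fin n) K))}
    resurgencePair (fun s => symbolicPower I s) (fun r => (𝔪 ^ N * I) ^ r)
      = ((N + t) * (m - t + 1) : ℕ) / (m : ℝ) ∧
    asympResurgencePair (fun s => symbolicPower I s) (fun r => (𝔪 ^ N * I) ^ r)
      = ((N + t) * (m - t + 1) : ℕ) / (m : ℝ) := by
  intro m 𝔪 I
  have htj : t ≤ j := ht.trans (min_le_left _ _)
  have htn : t ≤ n + 1 - j := ht.trans (min_le_right _ _)
  have hI : I = HankelRes.Im K n j t := by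
    have hx : ∀ (a : Fin j) (b : Fin (n + 1 - j)) (h : a.1 + b.1 < n),
        (MvPolynomial.X ⟨a.1 + b.1, h⟩ : MvPolynomial (Fin n) K) =
          HankelRes.xx K n (a.1 + b.1) := by
      intro a b h
      rw [HankelRes.xx, dif_pos h]
    simp only [I, HankelRes.Im, hx]
  have h1 : ∀ s r : ℕ, r * ((N + t) * (m - t + 1)) ≤ m * s →
      symbolicPower I s ≤ (𝔪 ^ N * I) ^ r := by
    intro s r h
    rw [hI]
    exact HankelRes.upper j t N s r hj ht1 htj htn h
  have h2 : ∀ s r a : ℕ, symbolicPower I s ≤ (𝔪 ^ N * I) ^ r → s ≤ (m - t + 1) * a →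
      r * (N + t) ≤ a * m := by
    intro s r a h hs
    rw [hI] at h
    exact HankelRes.lower j t N s r a hj ht1 htj htn h hs
  exact HankelRes.final_sup (fun s r => symbolicPower I s ≤ (𝔪 ^ N * I) ^ r) m (m - t + 1) (N + t)
    (by simp only [m]; omega) (by omega) (by omega) h1 h2
end
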